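/- arXiv:0804.2080 — 2 statements merged into one kernel-verified Lean document; each statement's English description precedes it below -/
import Mathlib

section
/- Let B be an admissible bilinear form on 'f and 𝕴 = { x ∈ 'f : B(x,y) = 0 for all y ∈ 'f } its radical. Then 𝕴 equals the two-sided ideal of 'f generated by the quantum Serre elements Σ_{a=0}^{d_{ij}+1} (-1)^a θ_i^{(a)} θ_j θ_i^{(d_{ij}+1-a)}, over all i,j ∈ I with i ≠ j. -/
open scoped TensorProduct

noncomputable section

/-- The ground field `𝕂 = ℚ(q)`. -/
abbrev K : Type := RatFunc ℚ

/-- `q ∈ ℚ(q)`. -/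
abbrev qvar : K := RatFunc.X

/-- The free associative algebra `'f` on generators `θ i`, `i ∈ I`. -/
abbrev F (I : Type) : Type := FreeAlgebra K I

/-- The generators `θ i` of `'f`. -/
def θ {I : Type} (i : I) : F I := FreeAlgebra.ι K i

/-- A Cartan datum: a symmetric integer matrix with positive even diagonal such that
`2(i·j)/(i·i)` is a nonpositive integer for `i ≠ j`. -/
def CartanDatum {I : Type} (c : I → I → ℤ) : Prop :=
  (∀ i j, c i j = c j i) ∧ (∀ i, 0 < c i i ∧ Even (c i i)) ∧
    (∀ i j, i ≠ j → c i j ≤ 0 ∧ c i i ∣ 2 * c i j)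

/-- `q_i = q^{(i·i)/2}`. -/
def qi {I : Type} (c : I → I → ℤ) (i : I) : K := qvar ^ (c i i / 2)

/-- The bilinear extension of `·` to weights: `ν·μ = Σ_{i,j} ν(i) μ(j) (i·j)`. -/
def wtPair {I : Type} (c : I → I → ℤ) (ν μ : I →₀ ℕ) : ℤ :=
  ν.sum fun i a => μ.sum fun j b => (a : ℤ) * (b : ℤ) * c i j

/-- The subspace of `'f` of homogeneous elements of weight `ν ∈ ℕ[I]`: the span of
all words `θ_{i_1} ⋯ θ_{i_r}` whose letters have multiplicities `ν`. -/
def wtSpace {I : Type} [DecidableEq I] (ν : I →₀ ℕ) : Submodule K (F I) :=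
  Submodule.span K
    {x | ∃ l : List I, Multiset.toFinsupp (l : Multiset I) = ν ∧ x = (l.map θ).prod}

/-- The twisted multiplication on `'f ⊗ 'f`:
`(x₁⊗x₂)(y₁⊗y₂) = q^{-|x₂|·|y₁|} (x₁y₁)⊗(x₂y₂)` on homogeneous elements. -/
def IsTwistedMul {I : Type} [DecidableEq I] (c : I → I → ℤ)
    (m : F I ⊗[K] F I →ₗ[K] F I ⊗[K] F I →ₗ[K] F I ⊗[K] F I) : Prop :=
  ∀ (ν μ : I →₀ ℕ) (x₁ x₂ y₁ y₂ : F I), x₂ ∈ wtSpace ν → y₁ ∈ wtSpace μ →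
    m (x₁ ⊗ₜ[K] x₂) (y₁ ⊗ₜ[K] y₂) =
      (qvar ^ (-(wtPair c ν μ))) • ((x₁ * y₁) ⊗ₜ[K] (x₂ * y₂))

/-- `r : 'f → 'f ⊗ 'f` is an algebra homomorphism to the twisted tensor square with
`r(θ_i) = θ_i ⊗ 1 + 1 ⊗ θ_i`. -/
def IsComult {I : Type} (m : F I ⊗[K] F I →ₗ[K] F I ⊗[K] F I →ₗ[K] F I ⊗[K] F I)
    (r : F I →ₗ[K] F I ⊗[K] F I) : Prop :=
  r 1 = (1 : F I) ⊗ₜ[K] (1 : F I) ∧ (∀ x y, r (x * y) = m (r x) (r y)) ∧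
    ∀ i, r (θ i) = θ i ⊗ₜ[K] 1 + 1 ⊗ₜ[K] θ i

/-- The bilinear form `B⊗B` on `'f ⊗ 'f`, `(B⊗B)(x₁⊗x₂, y₁⊗y₂) = B(x₁,y₁)B(x₂,y₂)`. -/
def BB {I : Type} (B : F I →ₗ[K] F I →ₗ[K] K) :
    F I ⊗[K] F I →ₗ[K] F I ⊗[K] F I →ₗ[K] K :=
  LinearMap.BilinForm.tmul B B

/-- Admissibility of a bilinear form on `'f`. -/
def Admissible {I : Type} [DecidableEq I] (c : I → I → ℤ) (r : F I →ₗ[K] F I ⊗[K] F I)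
    (B : F I →ₗ[K] F I →ₗ[K] K) : Prop :=
  B 1 1 = 1 ∧
    (∀ i j, B (θ i) (θ j) = if i = j then (1 - qi c i ^ 2)⁻¹ else 0) ∧
    (∀ x y y', B x (y * y') = BB B (r x) (y ⊗ₜ[K] y')) ∧
    (∀ x x' y, B (x * x') y = BB B (x ⊗ₜ[K] x') (r y))


/-- The quantum integer [n]_i = q_i^{n-1} + q_i^{n-3} + ⋯ + q_i^{1-n}. -/
def qint {I : Type} (c : I → I → ℤ) (i : I) (n : ℕ) : K :=
  ∑ k ∈ Finset.range n, qi c i ^ ((n : ℤ) - 1 - 2 * (k : ℤ))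

/-- The quantum factorial [n]_i!. -/
def qfact {I : Type} (c : I → I → ℤ) (i : I) (n : ℕ) : K :=
  ∏ k ∈ Finset.range n, qint c i (k + 1)

/-- The divided power θ_i^{(n)} = θ_i^n / [n]_i!. -/
def θdp {I : Type} (c : I → I → ℤ) (i : I) (n : ℕ) : F I :=
  (qfact c i n)⁻¹ • (θ i) ^ n

/-- d_{ij} = -2(i·j)/(i·i). -/
def dij {I : Type} (c : I → I → ℤ) (i j : I) : ℕ := ((-(2 * c i j)) / c i i).toNat

/-- The quantum Serre element Σ_{a=0}^{d_{ij}+1} (-1)^a θ_i^{(a)} θ_j θ_i^{(d_{ij}+1-a)}. -/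
def serreElem {I : Type} (c : I → I → ℤ) (i j : I) : F I :=
  ∑ a ∈ Finset.range (dij c i j + 2),
    ((-1 : K) ^ a) • (θdp c i a * θ j * θdp c i (dij c i j + 1 - a))

namespace SerreRad

set_option linter.unusedSectionVars false
set_option linter.unusedSimpArgs false

variable {I : Type}

/-- words -/
def word (w : List I) : F I := (w.map θ).prod

@[simp] lemma word_nil : word ([] : List I) = 1 := rfl
@[simp] lemma word_cons (i : I) (w : List I) : word (i :: w) = θ i * word w := by simp [word]
@[simp] lemma word_append (v w : List I) : word (v ++ w) = word v * word w := by simp [word]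
lemma word_singleton (i : I) : word [i] = θ i := by simp

/-- the basis of words -/
def wbasis (I : Type) : Module.Basis (List I) K (F I) :=
  (FreeAlgebra.basisFreeMonoid K I).reindex FreeMonoid.toList

lemma equiv_word (w : List I) :
    FreeAlgebra.equivMonoidAlgebraFreeMonoid (R := K) (word w) =
      MonoidAlgebra.single (FreeMonoid.ofList w) 1 := by
  induction w with
  | nil => simp; rfl
  | cons i w ih =>
    rw [word_cons, map_mul, ih]
    simp [θ, FreeAlgebra.equivMonoidAlgebraFreeMonoid, MonoidAlgebra.of_apply,
      MonoidAlgebra.single_mul_single]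

lemma wbasis_apply (w : List I) : wbasis I w = word w := by
  apply (FreeAlgebra.equivMonoidAlgebraFreeMonoid (R := K) (X := I)).injective
  rw [equiv_word]
  rw [wbasis, Module.Basis.reindex_apply, FreeAlgebra.basisFreeMonoid, Module.Basis.map_apply]
  simp

lemma word_ext {M : Type*} [AddCommMonoid M] [Module K M] {f g : F I →ₗ[K] M}
    (h : ∀ w, f (word w) = g (word w)) : f = g :=
  (wbasis I).ext fun w => by rw [wbasis_apply, h]

lemma span_word : Submodule.span K (Set.range (word (I := I))) = ⊤ := by
  rw [← (wbasis I).span_eq]; congr; ext w; rw [wbasis_apply]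

/-- define linear map on words -/
def onWords {M : Type*} [AddCommMonoid M] [Module K M] (f : List I → M) : F I →ₗ[K] M :=
  (wbasis I).constr K f

@[simp] lemma onWords_word {M : Type*} [AddCommMonoid M] [Module K M] (f : List I → M) (w : List I) :
    onWords f (word w) = f w := by
  rw [onWords, ← wbasis_apply, Module.Basis.constr_basis]

lemma word_induction {p : F I → Prop} (x : F I) (hw : ∀ w, p (word w))
    (hadd : ∀ x y, p x → p y → p (x + y)) (hs : ∀ (a : K) x, p x → p (a • x)) : p x := by
  have hx : x ∈ Submodule.span K (Set.range (word (I := I))) := by rw [span_word]; trivial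
  induction hx using Submodule.span_induction with
  | mem x h => obtain ⟨w, rfl⟩ := h; exact hw w
  | zero => simpa using hs 0 _ (hw [])
  | add x y _ _ hx hy => exact hadd x y hx hy
  | smul a x _ hx => exact hs a x hx

/-- the grading automorphism -/
def tau (c : I → I → ℤ) (k : I) : F I →ₐ[K] F I :=
  FreeAlgebra.lift K fun j => (qvar ^ (-(c k j))) • θ j

@[simp] lemma tau_theta (c : I → I → ℤ) (k j : I) : tau c k (θ j) = (qvar ^ (-(c k j))) • θ j := by
  simp [tau, θ]

/-- pairing of a letter with a word -/
def lp (c : I → I → ℤ) (k : I) (w : List I) : ℤ := (w.map (c k)).sum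

lemma qvar_ne : qvar ≠ 0 := RatFunc.X_ne_zero

lemma tau_word (c : I → I → ℤ) (k : I) (w : List I) :
    tau c k (word w) = (qvar ^ (-(lp c k w))) • word w := by
  induction w with
  | nil => simp [lp]
  | cons i w ih =>
    simp only [word_cons, map_mul, ih, tau_theta, lp, List.map_cons, List.sum_cons, neg_add,
      zpow_add₀ qvar_ne]
    simp only [Algebra.mul_smul_comm, Algebra.smul_mul_assoc, mul_smul]
    rw [smul_comm]

/-- auxiliary matrix representation -/
def Dmat [DecidableEq I] (c : I → I → ℤ) (k : I) : F I →ₐ[K] Matrix (Fin 2) (Fin 2) (F I) :=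
  FreeAlgebra.lift K fun j =>
    !![θ j, if j = k then 1 else 0; 0, (qvar ^ (-(c k j))) • θ j]

lemma Dmat_struct [DecidableEq I] (c : I → I → ℤ) (k : I) (x : F I) :
    Dmat c k x 0 0 = x ∧ Dmat c k x 1 0 = 0 ∧ Dmat c k x 1 1 = tau c k x := by
  induction x using FreeAlgebra.induction with
  | grade0 a => simp [Matrix.algebraMap_matrix_apply]
  | grade1 j => 
    have : tau c k (FreeAlgebra.ι K j) = _ := tau_theta c k j
    rw [this]; simp [Dmat, θ]
  | mul x y hx hy => simp [Matrix.mul_apply, hx, hy]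
  | add x y hx hy => simp [hx, hy]

/-- right skew derivation -/
def D [DecidableEq I] (c : I → I → ℤ) (k : I) : F I →ₗ[K] F I where
  toFun x := Dmat c k x 0 1
  map_add' x y := by simp
  map_smul' a x := by simp

variable [DecidableEq I]

lemma D_mul (c : I → I → ℤ) (k : I) (x y : F I) :
    D c k (x * y) = D c k x * tau c k y + x * D c k y := by
  simp [D, Matrix.mul_apply, Dmat_struct, add_comm]

@[simp] lemma D_theta (c : I → I → ℤ) (k j : I) : D c k (θ j) = if j = k then 1 else 0 := by
  simp [D, Dmat, θ]

@[simp] lemma D_one (c : I → I → ℤ) (k : I) : D c k (1 : F I) = 0 := by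
  simp [D]

/-- reversal -/
def sg : F I →ₗ[K] F I where
  toFun x := star x
  map_add' x y := by simp
  map_smul' a x := by
    rw [Algebra.smul_def, star_mul, FreeAlgebra.star_algebraMap, ← Algebra.commutes, Algebra.smul_def]; rfl

lemma sg_mul (x y : F I) : sg (x * y) = sg y * sg x := star_mul x y
@[simp] lemma sg_sg (x : F I) : sg (sg x) = x := star_star x
@[simp] lemma sg_theta (j : I) : sg (θ j) = θ j := FreeAlgebra.star_ι j
@[simp] lemma sg_one : sg (1 : F I) = 1 := star_one _
lemma sg_pow (x : F I) (n : ℕ) : sg (x ^ n) = sg x ^ n := star_pow x n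
lemma sg_word (w : List I) : sg (word w) = word w.reverse := by
  induction w with
  | nil => simp
  | cons i w ih => simp [sg_mul, ih]

lemma sg_tau (c : I → I → ℤ) (k : I) (x : F I) : sg (tau c k x) = tau c k (sg x) := by
  induction x using word_induction with
  | hw w => 
    rw [tau_word, map_smul, sg_word, tau_word]; simp [lp, List.sum_reverse]
  | hadd x y hx hy => simp [hx, hy]
  | hs a x hx => simp [hx]

/-- left skew derivation -/
def E (c : I → I → ℤ) (k : I) : F I →ₗ[K] F I := sg ∘ₗ D c k ∘ₗ sg

lemma E_mul (c : I → I → ℤ) (k : I) (x y : F I) :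
    E c k (x * y) = E c k x * y + tau c k x * E c k y := by
  simp [E, sg_mul, D_mul, sg_tau, add_comm]

@[simp] lemma E_theta (c : I → I → ℤ) (k j : I) : E c k (θ j) = if j = k then 1 else 0 := by
  simp [E]; split_ifs <;> simp

/-- exponent -/
def ex (c : I → I → ℤ) : List I → ℤ
  | [] => 0
  | j :: w => ex c w + lp c j w

lemma ex_concat (c : I → I → ℤ) (hs : ∀ i j, c i j = c j i) (w : List I) (j : I) :
    ex c (w ++ [j]) = ex c w + lp c j w := by
  induction w with
  | nil => simp [ex, lp]
  | cons i w ih =>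
    rw [List.cons_append, ex, ih, ex]; simp [lp, hs i j]; ring

lemma two_ex (c : I → I → ℤ) (hs : ∀ i j, c i j = c j i) (w : List I) :
    2 * ex c w + (w.map fun i => c i i).sum = (w.map fun i => lp c i w).sum := by
  induction w with
  | nil => simp [ex]
  | cons i w ih =>
    have : (w.map fun j => lp c j (i :: w)).sum = lp c i w + (w.map fun j => lp c j w).sum := by
      rw [lp, ← List.sum_map_add]
      congr 1; apply List.map_congr_left; intro j _; simp [lp, hs i j]
    simp only [List.map_cons, List.sum_cons, this, ex, ← ih]
    simp [lp]; ring

/-- antipode -/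
def S (c : I → I → ℤ) : F I →ₗ[K] F I :=
  onWords fun w => ((-1 : K) ^ w.length * qvar ^ (-(ex c w))) • word w.reverse

@[simp] lemma S_one (c : I → I → ℤ) : S c (1 : F I) = 1 := by
  rw [← word_nil, S, onWords_word]; simp [ex]

lemma S_tau (c : I → I → ℤ) (k : I) (x : F I) : S c (tau c k x) = tau c k (S c x) := by
  induction x using word_induction with
  | hw w => 
    rw [tau_word, map_smul, S, onWords_word, map_smul, tau_word]; simp [lp, List.sum_reverse, smul_smul, mul_comm]
  | hadd x y hx hy => simp [hx, hy]
  | hs a x hx => simp [hx]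

lemma S_mul_theta (c : I → I → ℤ) (hs : ∀ i j, c i j = c j i) (x : F I) (j : I) :
    S c (x * θ j) = - (θ j * S c (tau c j x)) := by
  induction x using word_induction with
  | hw w => 
    rw [← word_singleton, ← word_append, S, onWords_word, tau_word, map_smul, onWords_word,
      ex_concat c hs]
    simp [smul_smul, neg_add, zpow_add₀ qvar_ne, pow_succ]
    congr 1; ring
  | hadd x y hx hy => simp [hx, hy, add_mul, mul_add]; abel
  | hs a x hx => simp [hx]

/-- projection to weight component -/
def proj (ν : Multiset I) : F I →ₗ[K] F I :=
  onWords fun w => if (w : Multiset I) = ν then word w else 0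

/-- weight space -/
def Wt (ν : Multiset I) : Submodule K (F I) := Submodule.span K {x | ∃ w : List I, (w : Multiset I) = ν ∧ x = word w}

lemma proj_mem (ν : Multiset I) (x : F I) : proj ν x ∈ Wt ν := by
  induction x using word_induction with
  | hw w => 
    rw [proj, onWords_word]
    split_ifs with h
    · exact Submodule.subset_span ⟨w, h, rfl⟩
    · exact zero_mem _
  | hadd x y hx hy => rw [map_add]; exact add_mem hx hy
  | hs a x hx => rw [map_smul]; exact Submodule.smul_mem _ _ hx

lemma proj_sum (x : F I) : ∃ s : Finset (Multiset I), ∀ t, s ⊆ t → ∑ ν ∈ t, proj ν x = x := by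
  induction x using word_induction with
  | hw w => 
    refine ⟨{(w : Multiset I)}, fun t ht => ?_⟩
    simp only [proj, onWords_word]
    rw [Finset.sum_ite_eq, if_pos (ht (by simp))]
  | hadd x y hx hy => 
    obtain ⟨s, hs⟩ := hx
    obtain ⟨s', hs'⟩ := hy
    refine ⟨s ∪ s', fun t ht => ?_⟩
    simp only [map_add, Finset.sum_add_distrib]
    rw [hs t (Finset.union_subset_left ht), hs' t (Finset.union_subset_right ht)]
  | hs a x hx =>
    obtain ⟨s, hs⟩ := hx
    exact ⟨s, fun t ht => by simp only [map_smul, ← Finset.smul_sum, hs t ht]⟩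

lemma mem_of_proj_mem (N : Submodule K (F I)) (x : F I) (h : ∀ ν, proj ν x ∈ N) : x ∈ N := by
  obtain ⟨s, hs⟩ := proj_sum x
  rw [← hs s subset_rfl]
  exact Submodule.sum_mem _ fun ν _ => h ν

end SerreRad

namespace SerreRad

set_option linter.unusedSectionVars false
set_option linter.unusedSimpArgs false

variable {I : Type}

lemma qvar_pow_ne_one {n : ℕ} (hn : n ≠ 0) : qvar ^ n ≠ 1 := by
  intro h
  have h1 : (algebraMap (Polynomial ℚ) (RatFunc ℚ)) (Polynomial.X ^ n) =
      algebraMap (Polynomial ℚ) (RatFunc ℚ) 1 := by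
    simpa [RatFunc.algebraMap_X] using h
  have h2 := RatFunc.algebraMap_injective ℚ h1
  have h3 := congrArg Polynomial.natDegree h2
  simp at h3
  exact hn h3

lemma qvar_zpow_eq_one {z : ℤ} (h : qvar ^ z = 1) : z = 0 := by
  by_contra hz
  apply qvar_pow_ne_one (n := z.natAbs) (by omega)
  rcases Int.natAbs_eq z with h' | h'
  · rw [h', zpow_natCast] at h; exact h
  · rw [h', zpow_neg, inv_eq_one, zpow_natCast] at h; exact h

/-- t-integers -/
def tn (t : K) (n : ℕ) : K := ∑ k ∈ Finset.range n, t ^ k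

@[simp] lemma tn_zero (t : K) : tn t 0 = 0 := by simp [tn]
@[simp] lemma tn_one (t : K) : tn t 1 = 1 := by simp [tn]

lemma tn_succ (t : K) (n : ℕ) : tn t (n + 1) = t * tn t n + 1 := by
  rw [tn, Finset.sum_range_succ', tn, Finset.mul_sum]; simp [pow_succ, mul_comm]

lemma tn_ne_zero {z : ℤ} (hz : z ≠ 0) {n : ℕ} (hn : n ≠ 0) : tn (qvar ^ z) n ≠ 0 := by
  intro h
  have h1 := geom_sum_mul (qvar ^ z) n
  rw [← tn, h, zero_mul] at h1
  have h2 : qvar ^ (z * n) = 1 := by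
    rw [zpow_mul, zpow_natCast]; linear_combination -h1
  have := qvar_zpow_eq_one h2
  simp [hz, hn] at this

section
variable (c : I → I → ℤ) (i : I)

lemma qi_ne : qi c i ≠ 0 := zpow_ne_zero _ qvar_ne

lemma t_eq (hc : CartanDatum c) : qvar ^ (-(c i i)) = qi c i ^ (-2 : ℤ) := by
  obtain ⟨_, h⟩ := hc.2.1 i
  rw [qi, ← zpow_mul]; congr 1; obtain ⟨k, hk⟩ := h; omega

lemma tn_eq (hc : CartanDatum c) (n : ℕ) :
    tn (qvar ^ (-(c i i))) n = qi c i ^ (1 - (n : ℤ)) * qint c i n := by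
  rw [t_eq c i hc, tn, qint, Finset.mul_sum]
  apply Finset.sum_congr rfl
  intro k _
  rw [← zpow_add₀ (qi_ne c i), ← zpow_natCast, ← zpow_mul]; congr 1; ring

lemma qint_ne (hc : CartanDatum c) {n : ℕ} (hn : n ≠ 0) : qint c i n ≠ 0 := by
  intro h
  have := tn_ne_zero (z := -(c i i)) (by have := (hc.2.1 i).1; omega) hn
  rw [tn_eq c i hc, h, mul_zero] at this
  exact this rfl

lemma qfact_ne (hc : CartanDatum c) (n : ℕ) : qfact c i n ≠ 0 := by
  rw [qfact, Finset.prod_ne_zero_iff]; intro k _; exact qint_ne c i hc (by omega)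

lemma qfact_succ (n : ℕ) : qfact c i (n + 1) = qfact c i n * qint c i (n + 1) := by
  rw [qfact, Finset.prod_range_succ, qfact]

@[simp] lemma qfact_zero : qfact c i 0 = 1 := by simp [qfact]
@[simp] lemma qint_zero : qint c i 0 = 0 := by simp [qint]

lemma qint_add (a b : ℕ) :
    qint c i (a + b) = qi c i ^ (b : ℤ) * qint c i a + qi c i ^ (-(a : ℤ)) * qint c i b := by
  rw [qint, Finset.sum_range_add, qint, qint, Finset.mul_sum, Finset.mul_sum]
  congr 1
  all_goals
    apply Finset.sum_congr rfl
    intro k _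
    rw [← zpow_add₀ (qi_ne c i)]; congr 1; push_cast; ring

lemma qi_pow_d (hc : CartanDatum c) {j : I} (hij : i ≠ j) :
    qvar ^ (-(c i j)) = qi c i ^ (dij c i j : ℤ) := by
  obtain ⟨hpos, h2⟩ := hc.2.1 i
  obtain ⟨hle, k, hk⟩ := hc.2.2 i j hij
  rw [qi, ← zpow_mul]; congr 1
  have hk0 : k ≤ 0 := by nlinarith
  have hd : dij c i j = (-k).toNat := by
    rw [dij, hk]; congr 1
    rw [← mul_neg]; exact Int.mul_ediv_cancel_left _ hpos.ne'
  rw [hd, Int.toNat_of_nonneg (by omega)]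
  obtain ⟨m, hm⟩ := h2
  have : c i i / 2 = m := by omega
  rw [this]
  rw [hm] at hk
  linarith

lemma qsum_zero (hc : CartanDatum c) (d : ℕ) :
    ∑ a ∈ Finset.range (d + 2), (-1 : K) ^ a * ((qfact c i a)⁻¹ * (qfact c i (d + 1 - a))⁻¹ *
      qi c i ^ ((d : ℤ) * ((d + 1 - a : ℕ) : ℤ))) = 0 := by
  have hQ := qi_ne c i
  have hn : qint c i (d + 1) ≠ 0 := qint_ne c i hc (by omega)
  apply (mul_eq_zero.mp ?_).resolve_left hn
  set G : ℕ → K := fun a => (-1 : K) ^ (a + 1) * (qint c i a * (qfact c i a)⁻¹ *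
    (qfact c i (d + 1 - a))⁻¹ * qi c i ^ (((d : ℤ) + 1) * ((d + 1 - a : ℕ) : ℤ))) with hG
  rw [Finset.mul_sum, Finset.sum_range_succ]
  have hstep : ∀ a ∈ Finset.range (d + 1), qint c i (d + 1) * ((-1 : K) ^ a *
      ((qfact c i a)⁻¹ * (qfact c i (d + 1 - a))⁻¹ *
      qi c i ^ ((d : ℤ) * ((d + 1 - a : ℕ) : ℤ)))) = G (a + 1) - G a := by
    intro a ha
    rw [Finset.mem_range] at ha
    obtain ⟨b, rfl⟩ : ∃ b, d = a + b := ⟨d - a, by omega⟩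
    simp only [hG]
    rw [show a + b + 1 - (a + 1) = b by omega, show a + b + 1 - a = b + 1 by omega,
      show a + b + 1 = a + (b + 1) by omega, qint_add, qfact_succ, qfact_succ]
    have h1 := qfact_ne c i hc a
    have h2 := qfact_ne c i hc b
    have h3 := qint_ne c i hc (n := a + 1) (by omega)
    have h4 := qint_ne c i hc (n := b + 1) (by omega)
    have e1 : qi c i ^ ((((a + b : ℕ) : ℤ) + 1) * ((b + 1 : ℕ) : ℤ)) =
        qi c i ^ (((a + b : ℕ) : ℤ) * ((b + 1 : ℕ) : ℤ)) * qi c i ^ ((b + 1 : ℕ) : ℤ) := by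
      rw [← zpow_add₀ hQ]; congr 1; ring
    have e2 : qi c i ^ ((((a + b : ℕ) : ℤ) + 1) * (b : ℤ)) =
        qi c i ^ (((a + b : ℕ) : ℤ) * ((b + 1 : ℕ) : ℤ)) * qi c i ^ (-(a : ℤ)) := by
      rw [← zpow_add₀ hQ]; congr 1; push_cast; ring
    rw [e1, e2]
    field_simp
    ring
  rw [Finset.sum_congr rfl hstep, Finset.sum_range_sub]
  simp [hG, pow_succ]
  ring

variable [DecidableEq I]

lemma tau_self_pow (k : I) (n : ℕ) : tau c k (θ i ^ n) = (qvar ^ (-(c k i))) ^ n • θ i ^ n := by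
  rw [map_pow, tau_theta, smul_pow]

lemma D_pow (n : ℕ) : D c i (θ i ^ n) = tn (qvar ^ (-(c i i))) n • θ i ^ (n - 1) := by
  induction n with
  | zero => simp
  | succ n ih =>
    rw [pow_succ, D_mul, ih, tau_theta, D_theta, tn_succ]
    rcases n with _ | n
    · simp
    · simp [add_smul, mul_smul, pow_succ]

lemma D_pow_ne {k : I} (h : i ≠ k) (n : ℕ) : D c k (θ i ^ n) = 0 := by
  induction n with
  | zero => simp
  | succ n ih => rw [pow_succ, D_mul, ih]; simp [h]

lemma D_pxp {x : F I} {u : K} (hx : tau c i x = u • x) (a b : ℕ) :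
    D c i (θ i ^ a * x * θ i ^ b) =
      ((qvar ^ (-(c i i))) ^ b * u * tn (qvar ^ (-(c i i))) a) • (θ i ^ (a - 1) * x * θ i ^ b)
      + tn (qvar ^ (-(c i i))) b • (θ i ^ a * x * θ i ^ (b - 1))
      + (qvar ^ (-(c i i))) ^ b • (θ i ^ a * D c i x * θ i ^ b) := by
  rw [D_mul, D_mul, D_pow, D_pow, tau_self_pow, hx]
  simp only [smul_mul_assoc, mul_smul_comm, add_mul, smul_add, smul_smul]
  rw [← mul_assoc ((qvar ^ (-(c i i))) ^ b) u]
  generalize ((qvar ^ (-(c i i))) ^ b * u * tn (qvar ^ (-(c i i))) a) • (θ i ^ (a - 1) * x * θ i ^ b) = X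
  rw [add_assoc, add_assoc, add_comm (tn _ b • _)]

lemma sg_serre (j : I) :
    sg (serreElem c i j) = (-1 : K) ^ (dij c i j + 1) • serreElem c i j := by
  rw [serreElem, map_sum, Finset.smul_sum, ← Finset.sum_range_reflect]
  apply Finset.sum_congr rfl
  intro a ha
  rw [Finset.mem_range] at ha
  obtain ⟨b, hb⟩ : ∃ b, dij c i j + 1 = a + b := ⟨dij c i j + 1 - a, by omega⟩
  rw [show dij c i j + 2 - 1 - a = b by omega, show dij c i j + 1 - b = a by omega,
    show dij c i j + 1 - a = b by omega, hb]
  simp only [map_smul, sg_mul, θdp, sg_pow, sg_theta, smul_smul]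
  rw [mul_assoc]
  congr 1
  rw [pow_add, mul_right_comm, ← mul_pow]; simp

lemma D_serre (hc : CartanDatum c) {j : I} (hij : i ≠ j) (k : I) : D c k (serreElem c i j) = 0 := by
  have hQ := qi_ne c i
  by_cases hki : i = k
  · subst hki
    have hx : tau c i (θ j) = qi c i ^ (dij c i j : ℤ) • θ j := by
      rw [tau_theta, qi_pow_d c i hc hij]
    have hD : D c i (θ j) = 0 := by simp [hij.symm]
    set d := dij c i j with hd
    have key : D c i (serreElem c i j) = 
        ∑ a ∈ Finset.range (d + 2), ((-1 : K) ^ a * ((qfact c i a)⁻¹ * (qfact c i (d + 1 - a))⁻¹ *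
          ((qvar ^ (-(c i i))) ^ (d + 1 - a) * qi c i ^ (d : ℤ) * tn (qvar ^ (-(c i i))) a))) •
            (θ i ^ (a - 1) * θ j * θ i ^ (d + 1 - a))
        + ∑ a ∈ Finset.range (d + 2), ((-1 : K) ^ a * ((qfact c i a)⁻¹ * (qfact c i (d + 1 - a))⁻¹ *
          tn (qvar ^ (-(c i i))) (d + 1 - a))) • (θ i ^ a * θ j * θ i ^ (d + 1 - a - 1)) := by
      rw [serreElem, map_sum, ← Finset.sum_add_distrib]
      apply Finset.sum_congr rfl
      intro a _
      simp only [map_smul, θdp, smul_mul_assoc, mul_smul_comm, D_pxp c i hx, hD, smul_add, smul_smul]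
      simp
      congr 2 <;> ring
    rw [key, Finset.sum_range_succ', Finset.sum_range_succ (n := d + 1)]
    simp only [tn_zero, mul_zero, zero_smul, add_zero, Nat.sub_self, ← Finset.sum_add_distrib]
    apply Finset.sum_eq_zero
    intro a ha
    rw [Finset.mem_range] at ha
    obtain ⟨b, hb⟩ : ∃ b, d = a + b := ⟨d - a, by omega⟩
    rw [hb, show a + b + 1 - (a + 1) = b by omega, show a + b + 1 - a - 1 = b by omega,
      show a + b + 1 - a = b + 1 by omega, show a + 1 - 1 = a by omega, ← add_smul]
    convert zero_smul K _ using 2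
    rw [tn_eq c i hc, tn_eq c i hc, qfact_succ, qfact_succ, t_eq c i hc]
    have h1 := qfact_ne c i hc a
    have h2 := qfact_ne c i hc b
    have h3 := qint_ne c i hc (n := a + 1) (by omega)
    have h4 := qint_ne c i hc (n := b + 1) (by omega)
    have e1 : (qi c i ^ (-2 : ℤ)) ^ b * qi c i ^ ((a + b : ℕ) : ℤ) * qi c i ^ (1 - ((a + 1 : ℕ) : ℤ)) =
      qi c i ^ (1 - ((b + 1 : ℕ) : ℤ)) := by
      rw [← zpow_natCast, ← zpow_mul, ← zpow_add₀ hQ, ← zpow_add₀ hQ]; congr 1; push_cast; ring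
    rw [← e1]
    field_simp
    ring
  · by_cases hkj : j = k
    · subst hkj
      have key : D c j (serreElem c i j) = (∑ a ∈ Finset.range (dij c i j + 2), 
        (-1 : K) ^ a * ((qfact c i a)⁻¹ * (qfact c i (dij c i j + 1 - a))⁻¹ *
        qi c i ^ ((dij c i j : ℤ) * ((dij c i j + 1 - a : ℕ) : ℤ)))) • θ i ^ (dij c i j + 1) := by
        rw [serreElem, map_sum, Finset.sum_smul]
        apply Finset.sum_congr rfl
        intro a ha
        rw [Finset.mem_range] at ha
        have e : θ i ^ (dij c i j + 1) = θ i ^ a * θ i ^ (dij c i j + 1 - a) := by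
          rw [← pow_add]; congr 1; omega
        simp only [map_smul, θdp, smul_mul_assoc, mul_smul_comm, D_mul, D_pow_ne c i hij,
          tau_self_pow, hc.1 j i, qi_pow_d c i hc hij, smul_smul]
        simp [smul_smul, e, zpow_mul]
        congr 1
        ring
      rw [key, qsum_zero c i hc, zero_smul]
    · rw [serreElem, map_sum]
      apply Finset.sum_eq_zero
      intro a _
      simp [θdp, D_mul, D_pow_ne c i hki, hkj]

end

/-- the Serre ideal -/
def Jt (c : I → I → ℤ) : TwoSidedIdeal (F I) :=
  TwoSidedIdeal.span {x : F I | ∃ i j : I, i ≠ j ∧ x = serreElem c i j}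

/-- the Serre ideal as a subspace -/
def J (c : I → I → ℤ) : Submodule K (F I) where
  carrier := {x | x ∈ Jt c}
  zero_mem' := (Jt c).zero_mem
  add_mem' := (Jt c).add_mem
  smul_mem' a x hx := by
    rw [Algebra.smul_def]; exact (Jt c).mul_mem_left _ _ hx

lemma mem_J {c : I → I → ℤ} {x : F I} : x ∈ J c ↔ x ∈ Jt c := Iff.rfl
lemma J_mul_left {c : I → I → ℤ} (x : F I) {y : F I} (h : y ∈ J c) : x * y ∈ J c :=
  (Jt c).mul_mem_left _ _ h
lemma J_mul_right {c : I → I → ℤ} {x : F I} (h : x ∈ J c) (y : F I) : x * y ∈ J c :=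
  (Jt c).mul_mem_right _ _ h

lemma serre_mem_J (c : I → I → ℤ) {i j : I} (h : i ≠ j) : serreElem c i j ∈ J c :=
  TwoSidedIdeal.subset_span ⟨i, j, h, rfl⟩

lemma J_le {c : I → I → ℤ} (N : Submodule K (F I)) (hl : ∀ x y, y ∈ N → x * y ∈ N)
    (hr : ∀ x y, x ∈ N → x * y ∈ N) (hs : ∀ i j, i ≠ j → serreElem c i j ∈ N) : J c ≤ N := by
  intro x hx
  have := TwoSidedIdeal.mem_span_iff.mp (mem_J.mp hx) (TwoSidedIdeal.mk' (N : Set (F I)) N.zero_mem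
    (fun h h' => N.add_mem h h') (fun h => N.neg_mem h) (fun h => hl _ _ h) (fun h => hr _ _ h))
    (by rintro _ ⟨i, j, h, rfl⟩; simpa using hs i j h)
  simpa using this

variable [DecidableEq I]

lemma sg_J {c : I → I → ℤ} {x : F I} (h : x ∈ J c) : sg x ∈ J c := by
  refine J_le (c := c) ((J c).comap sg) ?_ ?_ ?_ h
  · intro x y h; simp only [Submodule.mem_comap, sg_mul] at *; exact J_mul_right h _
  · intro x y h; simp only [Submodule.mem_comap, sg_mul] at *; exact J_mul_left _ h
  · intro i j h
    rw [Submodule.mem_comap, sg_serre]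
    exact Submodule.smul_mem _ _ (serre_mem_J c h)

lemma tau_serre (c : I → I → ℤ) (k i j : I) : tau c k (serreElem c i j) =
    ((qvar ^ (-(c k i))) ^ (dij c i j + 1) * qvar ^ (-(c k j))) • serreElem c i j := by
  rw [serreElem, map_sum, Finset.smul_sum]
  apply Finset.sum_congr rfl
  intro a ha
  rw [Finset.mem_range] at ha
  obtain ⟨b, hb⟩ : ∃ b, dij c i j + 1 = a + b := ⟨dij c i j + 1 - a, by omega⟩
  rw [show dij c i j + 1 - a = b by omega, hb]
  simp only [map_smul, θdp, map_mul, tau_self_pow, tau_theta, smul_mul_assoc, mul_smul_comm,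
    smul_smul]
  congr 1
  ring

lemma tau_J {c : I → I → ℤ} (k : I) {x : F I} (h : x ∈ J c) : tau c k x ∈ J c := by
  refine J_le (c := c) ((J c).comap (tau c k).toLinearMap) ?_ ?_ ?_ h
  · intro x y h
    simp only [Submodule.mem_comap, AlgHom.toLinearMap_apply, map_mul] at *
    exact J_mul_left _ h
  · intro x y h
    simp only [Submodule.mem_comap, AlgHom.toLinearMap_apply, map_mul] at *
    exact J_mul_right h _
  · intro i j h
    rw [Submodule.mem_comap, AlgHom.toLinearMap_apply, tau_serre]
    exact Submodule.smul_mem _ _ (serre_mem_J c h)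

lemma D_J {c : I → I → ℤ} (hc : CartanDatum c) (k : I) {x : F I} (h : x ∈ J c) : D c k x ∈ J c := by
  suffices J c ≤ (J c) ⊓ (J c).comap (D c k) from (this h).2
  refine J_le _ ?_ ?_ ?_
  · rintro x y ⟨h, h'⟩
    refine ⟨J_mul_left _ h, ?_⟩
    rw [SetLike.mem_coe, Submodule.mem_comap] at *
    rw [D_mul]
    refine add_mem ?_ (J_mul_left _ h')
    have : tau c k y ∈ J c := tau_J k h
    exact J_mul_left _ this
  · rintro x y ⟨h, h'⟩
    refine ⟨J_mul_right h _, ?_⟩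
    rw [SetLike.mem_coe, Submodule.mem_comap] at *
    rw [D_mul]
    exact add_mem (J_mul_right h' _) (J_mul_right h _)
  · intro i j h
    refine ⟨serre_mem_J c h, ?_⟩
    rw [SetLike.mem_coe, Submodule.mem_comap, D_serre c i hc h]
    exact zero_mem _

lemma E_J {c : I → I → ℤ} (hc : CartanDatum c) (k : I) {x : F I} (h : x ∈ J c) : E c k x ∈ J c :=
  sg_J (D_J hc k (sg_J h))

end SerreRad

namespace SerreRad

set_option linter.unusedSectionVars false
set_option linter.unusedSimpArgs false

variable {I : Type} [DecidableEq I]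

lemma toFinsupp_cons (j : I) (w : List I) : Multiset.toFinsupp ((j :: w : List I) : Multiset I) =
    Finsupp.single j 1 + Multiset.toFinsupp (w : Multiset I) := by
  rw [← Multiset.cons_coe, ← Multiset.singleton_add, map_add, Multiset.toFinsupp_singleton]

lemma wtPair_word (c : I → I → ℤ) (hs : ∀ i j, c i j = c j i) (w : List I) (j : I) :
    wtPair c (Multiset.toFinsupp (w : Multiset I)) (Multiset.toFinsupp (([j] : List I) : Multiset I))
      = lp c j w := by
  induction w with
  | nil => simp [wtPair, lp]
  | cons i w ih =>
    rw [toFinsupp_cons i w, wtPair, Finsupp.sum_add_index']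
    · have ih' := ih
      rw [wtPair] at ih'
      rw [ih']
      simp [lp, hs i j]
    · simp
    · intro a b b'
      rw [← Finsupp.sum_add]
      congr 1; ext; push_cast; ring

lemma wtPair_nil (c : I → I → ℤ) (ν : I →₀ ℕ) :
    wtPair c ν (Multiset.toFinsupp (([] : List I) : Multiset I)) = 0 := by
  simp [wtPair]

lemma word_mem_wtSpace (w : List I) : word w ∈ wtSpace (Multiset.toFinsupp (w : Multiset I)) :=
  Submodule.subset_span ⟨w, rfl, rfl⟩

lemma m_theta_left {c : I → I → ℤ} (hs : ∀ i j, c i j = c j i)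
    {m : F I ⊗[K] F I →ₗ[K] F I ⊗[K] F I →ₗ[K] F I ⊗[K] F I} (hm : IsTwistedMul c m) (j : I)
    (z : F I ⊗[K] F I) :
    m z (θ j ⊗ₜ 1) = TensorProduct.map (LinearMap.mulRight K (θ j)) (tau c j).toLinearMap z := by
  induction z using TensorProduct.induction_on with
  | zero => simp
  | add x y hx hy => simp [hx, hy]
  | tmul x y =>
    induction y using word_induction with
    | hw w =>
      rw [← word_singleton, hm _ _ _ _ _ _ (word_mem_wtSpace w) (word_mem_wtSpace [j]),
        wtPair_word c hs]
      simp [tau_word, TensorProduct.tmul_smul]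
    | hadd y y' h h' => simp only [TensorProduct.tmul_add, map_add, LinearMap.add_apply, h, h']
    | hs a y h => simp only [TensorProduct.tmul_smul, map_smul, LinearMap.smul_apply, h]

lemma m_theta_right {c : I → I → ℤ}
    {m : F I ⊗[K] F I →ₗ[K] F I ⊗[K] F I →ₗ[K] F I ⊗[K] F I} (hm : IsTwistedMul c m) (j : I)
    (z : F I ⊗[K] F I) :
    m z (1 ⊗ₜ θ j) = TensorProduct.map LinearMap.id (LinearMap.mulRight K (θ j)) z := by
  induction z using TensorProduct.induction_on with
  | zero => simp
  | add x y hx hy => simp [hx, hy]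
  | tmul x y =>
    induction y using word_induction with
    | hw w =>
      rw [← word_nil, hm _ _ _ _ _ _ (word_mem_wtSpace w) (word_mem_wtSpace []),
        wtPair_nil]
      simp
    | hadd y y' h h' => simp only [TensorProduct.tmul_add, map_add, LinearMap.add_apply, h, h']
    | hs a y h => simp only [TensorProduct.tmul_smul, map_smul, LinearMap.smul_apply, h]

/-- all data of the theorem -/
structure Data (c : I → I → ℤ) (r : F I →ₗ[K] F I ⊗[K] F I)
    (B : F I →ₗ[K] F I →ₗ[K] K) : Prop where
  hc : CartanDatum c
  r1 : r 1 = 1 ⊗ₜ 1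
  rmul : ∀ x j, r (x * θ j) = 
    TensorProduct.map (LinearMap.mulRight K (θ j)) (tau c j).toLinearMap (r x) +
    TensorProduct.map LinearMap.id (LinearMap.mulRight K (θ j)) (r x)
  rth : ∀ j, r (θ j) = θ j ⊗ₜ 1 + 1 ⊗ₜ θ j
  hB : Admissible c r B

lemma Data.mk' {c : I → I → ℤ} (hc : CartanDatum c)
    {m : F I ⊗[K] F I →ₗ[K] F I ⊗[K] F I →ₗ[K] F I ⊗[K] F I}
    (hm : IsTwistedMul c m)
    {r : F I →ₗ[K] F I ⊗[K] F I} (hr : IsComult m r)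
    {B : F I →ₗ[K] F I →ₗ[K] K} (hB : Admissible c r B) : Data c r B where
  hc := hc
  r1 := hr.1
  rmul x j := by rw [hr.2.1, hr.2.2, map_add, m_theta_left hc.1 hm, m_theta_right hm]
  rth := hr.2.2
  hB := hB

lemma BB_tmul (B : F I →ₗ[K] F I →ₗ[K] K) (x x' y y' : F I) :
    BB B (x ⊗ₜ x') (y ⊗ₜ y') = B x y * B x' y' := by
  simp [BB, mul_comm]

lemma BB_eq (B : F I →ₗ[K] F I →ₗ[K] K) (z : F I ⊗[K] F I) (y y' : F I) :
    BB B z (y ⊗ₜ y') = B (TensorProduct.rid K _ ((B.flip y').lTensor _ z)) y := by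
  induction z using TensorProduct.induction_on with
  | zero => simp
  | add x y hx hy => simp only [map_add, LinearMap.add_apply, hx, hy]
  | tmul x x' => rw [BB_tmul]; simp [mul_comm]

variable {c : I → I → ℤ} {r : F I →ₗ[K] F I ⊗[K] F I} {B : F I →ₗ[K] F I →ₗ[K] K}

section

lemma B_theta_one (h : Data c r B) (j : I) : B (θ j) 1 = 0 := by
  have h1 := h.hB.2.2.1 (θ j) 1 1
  rw [h.rth, map_add, LinearMap.add_apply, BB_tmul, BB_tmul, h.hB.1] at h1
  simpa using h1

lemma B_mul_one (h : Data c r B) (x y : F I) : B (x * y) 1 = B x 1 * B y 1 := by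
  rw [h.hB.2.2.2, h.r1, BB_tmul]

lemma eps_word (h : Data c r B) (w : List I) : B (word w) 1 = if w = [] then 1 else 0 := by
  cases w with
  | nil => simpa using h.hB.1
  | cons i w => simp [B_mul_one h, B_theta_one h]

lemma r_eps (h : Data c r B) (x : F I) : TensorProduct.rid K _ ((B.flip 1).lTensor _ (r x)) = x := by
  induction x using word_induction with
  | hadd x y hx hy => simp only [map_add, hx, hy]
  | hs a x hx => simp only [map_smul, hx]
  | hw w =>
    induction w using List.reverseRecOn with
    | nil => rw [word_nil, h.r1]; simp [h.hB.1]
    | append_singleton w j ih =>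
      rw [word_append, word_singleton, h.rmul, map_add, map_add]
      have e1 : ∀ z : F I ⊗[K] F I, TensorProduct.rid K _ ((B.flip 1).lTensor _ (TensorProduct.map 
          (LinearMap.mulRight K (θ j)) (tau c j).toLinearMap z)) =
          TensorProduct.rid K _ ((B.flip 1).lTensor _ z) * θ j := by
        intro z
        induction z using TensorProduct.induction_on with
        | zero => simp
        | add x y hx hy => simp only [map_add, hx, hy, add_mul]
        | tmul x x' => 
          simp only [TensorProduct.map_tmul, LinearMap.lTensor_tmul, TensorProduct.rid_tmul,
            LinearMap.flip_apply, AlgHom.toLinearMap_apply, LinearMap.mulRight_apply,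
            smul_mul_assoc]
          congr 1
          induction x' using word_induction with
          | hw w => rw [tau_word, map_smul, LinearMap.smul_apply, eps_word h]; split_ifs with h' <;> simp [h', lp]
          | hadd x y hx hy => simp only [map_add, LinearMap.add_apply, hx, hy]
          | hs a x hx => simp only [map_smul, LinearMap.smul_apply, hx]
      have e2 : ∀ z : F I ⊗[K] F I, TensorProduct.rid K _ ((B.flip 1).lTensor _ (TensorProduct.map 
          LinearMap.id (LinearMap.mulRight K (θ j)) z)) = 0 := by
        intro z
        induction z using TensorProduct.induction_on with
        | zero => simp
        | add x y hx hy => simp only [map_add, hx, hy, add_zero]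
        | tmul x x' => simp [B_mul_one h, B_theta_one h]
      rw [e1, e2, ih, add_zero]

lemma r_eps' (h : Data c r B) (x : F I) : TensorProduct.lid K _ ((B.flip 1).rTensor _ (r x)) = x := by
  induction x using word_induction with
  | hadd x y hx hy => simp only [map_add, hx, hy]
  | hs a x hx => simp only [map_smul, hx]
  | hw w =>
    induction w using List.reverseRecOn with
    | nil => rw [word_nil, h.r1]; simp [h.hB.1]
    | append_singleton w j ih =>
      rw [word_append, word_singleton, h.rmul, map_add, map_add]
      have e1 : ∀ z : F I ⊗[K] F I, TensorProduct.lid K _ ((B.flip 1).rTensor _ (TensorProduct.map 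
          (LinearMap.mulRight K (θ j)) (tau c j).toLinearMap z)) = 0 := by
        intro z
        induction z using TensorProduct.induction_on with
        | zero => simp
        | add x y hx hy => simp only [map_add, hx, hy, add_zero]
        | tmul x x' => simp [B_mul_one h, B_theta_one h]
      have e2 : ∀ z : F I ⊗[K] F I, TensorProduct.lid K _ ((B.flip 1).rTensor _ (TensorProduct.map 
          LinearMap.id (LinearMap.mulRight K (θ j)) z)) =
          TensorProduct.lid K _ ((B.flip 1).rTensor _ z) * θ j := by
        intro z
        induction z using TensorProduct.induction_on with
        | zero => simp
        | add x y hx hy => simp only [map_add, hx, hy, add_mul]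
        | tmul x x' => simp
      rw [e1, e2, ih, zero_add]

lemma r_D (h : Data c r B) (k : I) (x : F I) : TensorProduct.rid K _ ((B.flip (θ k)).lTensor _ (r x)) =
    B (θ k) (θ k) • D c k x := by
  induction x using word_induction with
  | hadd x y hx hy => simp only [map_add, hx, hy, smul_add]
  | hs a x hx => simp only [map_smul, hx]; rw [smul_comm]
  | hw w =>
    have hmul : ∀ x j, B (x * θ j) (θ k) = B x 1 * B (θ j) (θ k) := by
      intro x j
      rw [h.hB.2.2.2, h.rth, map_add, BB_tmul, BB_tmul, B_theta_one h]; simp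
    have h1k : B 1 (θ k) = 0 := by
      have h1 := h.hB.2.2.2 1 1 (θ k)
      rw [h.rth, map_add, BB_tmul, BB_tmul, h.hB.1] at h1
      simpa using h1
    induction w using List.reverseRecOn with
    | nil => rw [word_nil, h.r1]; simp [h1k]
    | append_singleton w j ih =>
      rw [word_append, word_singleton, h.rmul, map_add, map_add]
      have e1 : ∀ z : F I ⊗[K] F I, TensorProduct.rid K _ ((B.flip (θ k)).lTensor _ (TensorProduct.map 
          (LinearMap.mulRight K (θ j)) (tau c j).toLinearMap z)) =
          TensorProduct.rid K _ ((B.flip (θ k)).lTensor _ z) * tau c k (θ j) := by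
        intro z
        induction z using TensorProduct.induction_on with
        | zero => simp
        | add x y hx hy => simp only [map_add, hx, hy, add_mul]
        | tmul x x' => 
          simp only [TensorProduct.map_tmul, LinearMap.lTensor_tmul, TensorProduct.rid_tmul,
            LinearMap.flip_apply, AlgHom.toLinearMap_apply, LinearMap.mulRight_apply, tau_theta,
            smul_mul_assoc, mul_smul_comm, smul_smul]
          congr 1
          induction x' using word_induction with
          | hw w =>
            rw [tau_word, map_smul, LinearMap.smul_apply]
            cases w using List.reverseRecOn with
            | nil => simp [h1k]
            | append_singleton w l =>
              rw [word_append, word_singleton, hmul, eps_word h, h.hB.2.1]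
              by_cases hw : w = []
              · by_cases hlk : l = k
                · simp [hw, hlk, lp, h.hc.1 k j, mul_comm]
                · simp [hlk]
              · simp [hw]
          | hadd x y hx hy => simp only [map_add, LinearMap.add_apply, hx, hy, mul_add]
          | hs a x hx => simp only [map_smul, LinearMap.smul_apply, hx, smul_eq_mul]; ring
      have e2 : ∀ z : F I ⊗[K] F I, TensorProduct.rid K _ ((B.flip (θ k)).lTensor _ (TensorProduct.map 
          LinearMap.id (LinearMap.mulRight K (θ j)) z)) =
          B (θ j) (θ k) • TensorProduct.rid K _ ((B.flip 1).lTensor _ z) := by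
        intro z
        induction z using TensorProduct.induction_on with
        | zero => simp
        | add x y hx hy => simp only [map_add, hx, hy, smul_add]
        | tmul x x' => simp [hmul, mul_comm, smul_smul]
      rw [e1, e2, ih, r_eps h, D_mul, D_theta, h.hB.2.1 j k]
      by_cases hjk : j = k
      · subst hjk; simp [h.hB.2.1]; rw [smul_comm]
      · simp [hjk]; rw [smul_comm]

lemma B_mul_theta (h : Data c r B) (x y : F I) (k : I) : B x (y * θ k) = B (θ k) (θ k) * B (D c k x) y := by
  rw [h.hB.2.2.1, BB_eq, r_D h]; simp

lemma B_theta_ne (h : Data c r B) (k : I) : B (θ k) (θ k) ≠ 0 := by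
  rw [h.hB.2.1, if_pos rfl]
  apply inv_ne_zero
  intro h0
  have h1 : qvar ^ (c k k / 2 * 2) = 1 := by
    rw [zpow_mul]
    have : qi c k ^ 2 = 1 := by linear_combination -h0
    exact_mod_cast this
  have := qvar_zpow_eq_one h1
  have h2 := h.hc.2.1 k
  obtain ⟨_, m, hm⟩ := h2
  omega

lemma D_ker (h : Data c r B) {x : F I} (hx : x ∈ LinearMap.ker B) (k : I) : D c k x ∈ LinearMap.ker B := by
  rw [LinearMap.mem_ker] at *
  ext y
  have := B_mul_theta h x y k
  rw [hx] at this
  simpa [B_theta_ne h k] using this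

lemma ker_left (h : Data c r B) (x y : F I) (hy : y ∈ LinearMap.ker B) : x * y ∈ LinearMap.ker B := by
  rw [LinearMap.mem_ker] at *
  ext z
  rw [h.hB.2.2.2]
  generalize r z = t
  induction t using TensorProduct.induction_on with
  | zero => simp
  | add a b ha hb => rw [map_add, ha, hb]; simp
  | tmul a b => rw [BB_tmul, hy]; simp

lemma ker_right (h : Data c r B) (x y : F I) (hx : x ∈ LinearMap.ker B) : x * y ∈ LinearMap.ker B := by
  rw [LinearMap.mem_ker] at *
  ext z
  rw [h.hB.2.2.2]
  generalize r z = t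
  induction t using TensorProduct.induction_on with
  | zero => simp
  | add a b ha hb => rw [map_add, ha, hb]; simp
  | tmul a b => rw [BB_tmul, hx]; simp

lemma mem_ker_of_words (h : Data c r B) {x : F I} (hx : ∀ w, B x (word w) = 0) : x ∈ LinearMap.ker B := by
  rw [LinearMap.mem_ker]
  exact word_ext (by simpa using hx)

lemma J_le_ker (h : Data c r B) : J c ≤ LinearMap.ker B := by
  refine J_le _ (ker_left h) (ker_right h) ?_
  intro i j hij
  apply mem_ker_of_words h
  intro w
  cases w using List.reverseRecOn with
  | nil =>
    rw [serreElem]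
    simp [B_mul_one h, B_theta_one h]
  | append_singleton w k =>
    rw [word_append, word_singleton, B_mul_theta h, D_serre c i h.hc hij]; simp

lemma D_word_mem (h : Data c r B) (k : I) (w : List I) :
    D c k (word w) ∈ Submodule.span K {x | ∃ v : List I, k ::ₘ (v : Multiset I) = w ∧ x = word v} := by
  induction w using List.reverseRecOn with
  | nil => simp
  | append_singleton w j ih =>
    rw [word_append, word_singleton, D_mul, tau_theta, D_theta]
    refine add_mem ?_ ?_
    · rw [mul_smul_comm]
      apply Submodule.smul_mem
      have := Submodule.mem_map_of_mem (f := LinearMap.mulRight K (θ j)) ih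
      rw [Submodule.map_span] at this
      refine Submodule.span_mono ?_ this
      rintro _ ⟨_, ⟨v, hv, rfl⟩, rfl⟩
      refine ⟨v ++ [j], ?_, by simp⟩
      rw [← Multiset.coe_add, ← Multiset.coe_add, ← hv, Multiset.cons_add]
    · split_ifs with hj
      · subst hj
        refine Submodule.subset_span ⟨w, ?_, by simp⟩
        rw [← Multiset.coe_add, add_comm, Multiset.coe_singleton, Multiset.singleton_add]
      · simp

lemma B_word_word (h : Data c r B) (u w : List I) (huw : (u : Multiset I) ≠ w) : B (word u) (word w) = 0 := by
  induction w using List.reverseRecOn generalizing u with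
  | nil =>
    rw [word_nil, eps_word h, if_neg]; rintro rfl; exact huw rfl
  | append_singleton w k ih =>
    rw [word_append, word_singleton, B_mul_theta h]
    have : D c k (word u) ∈ LinearMap.ker (B.flip (word w)) := by
      refine Submodule.span_le.mpr ?_ (D_word_mem h k u)
      rintro _ ⟨v, hv, rfl⟩
      simp only [SetLike.mem_coe, LinearMap.mem_ker, LinearMap.flip_apply]
      apply ih
      intro hvw
      apply huw
      rw [← hv, hvw, ← Multiset.coe_add, add_comm, Multiset.coe_singleton, Multiset.singleton_add]
    simp only [LinearMap.mem_ker, LinearMap.flip_apply] at this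
    rw [this, mul_zero]

lemma B_proj (h : Data c r B) (ν : Multiset I) (x : F I) (w : List I) :
    B (proj ν x) (word w) = if (w : Multiset I) = ν then B x (word w) else 0 := by
  induction x using word_induction with
  | hadd x y hx hy => 
    simp only [map_add, LinearMap.add_apply, hx, hy]; split_ifs <;> simp
  | hs a x hx => simp only [map_smul, LinearMap.smul_apply, hx]; split_ifs <;> simp
  | hw u =>
    rw [proj, onWords_word]
    by_cases huw : (u : Multiset I) = w
    · rw [huw]; split_ifs <;> simp
    · rw [B_word_word h u w huw]; split_ifs <;> simp [B_word_word h u w huw]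

lemma proj_ker (h : Data c r B) {x : F I} (hx : x ∈ LinearMap.ker B) (ν : Multiset I) :
    proj ν x ∈ LinearMap.ker B := by
  apply mem_ker_of_words h
  intro w
  rw [B_proj h, LinearMap.mem_ker.mp hx]; simp

end

end SerreRad

namespace SerreRad

set_option linter.unusedSectionVars false
set_option linter.unusedSimpArgs false

variable {I : Type} [DecidableEq I]

lemma E_pxp (c : I → I → ℤ) (i : I) {x : F I} {u : K} (hx : tau c i x = u • x) (a b : ℕ) :
    E c i (θ i ^ a * x * θ i ^ b) =
      tn (qvar ^ (-(c i i))) a • (θ i ^ (a - 1) * x * θ i ^ b)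
      + ((qvar ^ (-(c i i))) ^ a * u * tn (qvar ^ (-(c i i))) b) • (θ i ^ a * x * θ i ^ (b - 1))
      + (qvar ^ (-(c i i))) ^ a • (θ i ^ a * E c i x * θ i ^ b) := by
  have h1 : tau c i (sg x) = u • sg x := by rw [← sg_tau, hx, map_smul]
  have h2 : sg (θ i ^ a * x * θ i ^ b) = θ i ^ b * sg x * θ i ^ a := by
    simp only [sg_mul, sg_pow, sg_theta, mul_assoc]
  rw [E, LinearMap.comp_apply, LinearMap.comp_apply, h2, D_pxp c i h1]
  simp only [map_add, map_smul, sg_mul, sg_pow, sg_theta, sg_sg, mul_assoc]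
  simp only [LinearMap.comp_apply]
  abel

lemma rel {c : I → I → ℤ} (hc : CartanDatum c) (i : I) {x : F I} (hx : x ∉ J c)
    (hD : D c i x ∈ J c) (hE : E c i x ∈ J c) {l : ℤ} (hl : 0 < l)
    (hu : tau c i x = (qvar ^ (-l)) • x) (N : ℕ) : ∀ (f : ℕ → K),
    ∑ a ∈ Finset.range (N + 1), f a • (θ i ^ a * x * θ i ^ (N - a)) ∈ J c →
    ∀ a ≤ N, f a = 0 := by
  induction N with
  | zero =>
    intro f hf a ha
    obtain rfl : a = 0 := by omega
    simp only [zero_add, Finset.range_one, Finset.sum_singleton, pow_zero, one_mul, mul_one,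
      Nat.sub_self] at hf
    by_contra h0
    exact hx ((Submodule.smul_mem_iff _ h0).mp hf)
  | succ N ih =>
    intro f hf
    set t : K := qvar ^ (-(c i i)) with ht
    set u : K := qvar ^ (-l) with hu'
    have hcp := (hc.2.1 i).1
    have e1 : ∀ a ≤ N, f (a + 1) * (t ^ (N - a) * u * tn t (a + 1)) + f a * tn t (N + 1 - a) = 0 := by
      have h1 := D_J hc i hf
      apply ih (fun a => f (a + 1) * (t ^ (N - a) * u * tn t (a + 1)) + f a * tn t (N + 1 - a))
      have h2 : ∑ a ∈ Finset.range (N + 1 + 1),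
          f a • (t ^ (N + 1 - a) • (θ i ^ a * D c i x * θ i ^ (N + 1 - a))) ∈ J c :=
        Submodule.sum_mem _ fun a _ => Submodule.smul_mem _ _ (Submodule.smul_mem _ _
          (J_mul_right (J_mul_left _ hD) _))
      have h3 := Submodule.sub_mem _ h1 h2
      convert h3 using 1
      rw [map_sum, ← Finset.sum_sub_distrib]
      simp only [map_smul, D_pxp c i hu, ← ht, smul_add, add_sub_cancel_right]
      rw [Finset.sum_add_distrib]
      conv_rhs => 
        enter [1]
        rw [Finset.sum_range_succ']
      conv_rhs => 
        enter [2]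
        rw [Finset.sum_range_succ]
      simp only [tn_zero, Nat.sub_self, mul_zero, zero_smul, smul_zero, add_zero]
      rw [← Finset.sum_add_distrib]
      apply Finset.sum_congr rfl
      intro a ha
      rw [add_smul, smul_smul, smul_smul]
      have : N + 1 - a - 1 = N - a := by omega
      simp only [Nat.add_sub_add_right, Nat.add_sub_cancel, this]
    have e2 : ∀ a ≤ N, f (a + 1) * tn t (a + 1) + f a * (t ^ a * u * tn t (N + 1 - a)) = 0 := by
      have h1 := E_J hc i hf
      apply ih (fun a => f (a + 1) * tn t (a + 1) + f a * (t ^ a * u * tn t (N + 1 - a)))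
      have h2 : ∑ a ∈ Finset.range (N + 1 + 1),
          f a • (t ^ a • (θ i ^ a * E c i x * θ i ^ (N + 1 - a))) ∈ J c :=
        Submodule.sum_mem _ fun a _ => Submodule.smul_mem _ _ (Submodule.smul_mem _ _
          (J_mul_right (J_mul_left _ hE) _))
      have h3 := Submodule.sub_mem _ h1 h2
      convert h3 using 1
      rw [map_sum, ← Finset.sum_sub_distrib]
      simp only [map_smul, E_pxp c i hu, ← ht, smul_add, add_sub_cancel_right]
      rw [Finset.sum_add_distrib]
      conv_rhs => 
        enter [1]
        rw [Finset.sum_range_succ']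
      conv_rhs => 
        enter [2]
        rw [Finset.sum_range_succ]
      simp only [tn_zero, Nat.sub_self, mul_zero, zero_smul, smul_zero, add_zero]
      rw [← Finset.sum_add_distrib]
      apply Finset.sum_congr rfl
      intro a ha
      rw [add_smul, smul_smul, smul_smul]
      have : N + 1 - a - 1 = N - a := by omega
      simp only [Nat.add_sub_add_right, Nat.add_sub_cancel, this]
    have hne : 1 - t ^ N * u ^ 2 ≠ 0 := by
      intro h0
      have h1 : qvar ^ (-(c i i) * N + (-l) * 2) = 1 := by
        rw [zpow_add₀ qvar_ne, zpow_mul, zpow_mul]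
        have : t ^ N * u ^ 2 = 1 := by linear_combination -h0
        exact_mod_cast this
      have h2 := qvar_zpow_eq_one h1
      have : 0 ≤ c i i * N := by positivity
      linarith
    have hz : -(c i i) ≠ 0 := by omega
    have key : ∀ a ≤ N, f a = 0 ∧ f (a + 1) = 0 := by
      intro a ha
      have h1 := e1 a ha
      have h2 := e2 a ha
      have htt : t ^ (N - a) * t ^ a = t ^ N := by rw [← pow_add]; congr 1; omega
      have hg : f a * tn t (N + 1 - a) = 0 := by
        have : (f a * tn t (N + 1 - a)) * (1 - t ^ N * u ^ 2) = 0 := by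
          rw [← htt]
          linear_combination h1 - t ^ (N - a) * u * h2
        exact (mul_eq_zero.mp this).resolve_right hne
      have hf0 : f a = 0 := (mul_eq_zero.mp hg).resolve_right (tn_ne_zero hz (by omega))
      refine ⟨hf0, ?_⟩
      rw [hf0, zero_mul, add_zero] at h2
      exact (mul_eq_zero.mp h2).resolve_right (tn_ne_zero hz (by omega))
    intro a ha
    rcases Nat.lt_or_ge N a with h | h
    · obtain rfl : a = N + 1 := by omega
      exact (key N le_rfl).2
    · exact (key a h).1

/-- local nilpotency-type property -/
def PP (c : I → I → ℤ) (i : I) (x : F I) : Prop :=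
  ∃ N : ℕ, ∃ U : Submodule K (F I), U.FG ∧ ∀ m, ∃ u ∈ U, θ i ^ (m + N) * x - u * θ i ^ m ∈ J c

lemma PP_shift {c : I → I → ℤ} {i : I} {x : F I} {N : ℕ} {U : Submodule K (F I)} (hU : U.FG)
    (h : ∀ m, ∃ u ∈ U, θ i ^ (m + N) * x - u * θ i ^ m ∈ J c) (k : ℕ) :
    ∃ U : Submodule K (F I), U.FG ∧
      ∀ m, ∃ u ∈ U, θ i ^ (m + (N + k)) * x - u * θ i ^ m ∈ J c := by
  refine ⟨U.map (LinearMap.mulRight K (θ i ^ k)), hU.map _, fun m => ?_⟩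
  obtain ⟨u, hu, h1⟩ := h (m + k)
  refine ⟨_, Submodule.mem_map_of_mem hu, ?_⟩
  rw [LinearMap.mulRight_apply, mul_assoc, ← pow_add, add_comm k m]
  convert h1 using 4
  ring

lemma PP_add {c : I → I → ℤ} {i : I} {x y : F I} (hx : PP c i x) (hy : PP c i y) :
    PP c i (x + y) := by
  obtain ⟨N, U, hU, h⟩ := hx
  obtain ⟨N', U', hU', h'⟩ := hy
  obtain ⟨V, hV, h1⟩ := PP_shift hU h N'
  obtain ⟨V', hV', h1'⟩ := PP_shift hU' h' N
  refine ⟨N + N', V ⊔ V', hV.sup hV', fun m => ?_⟩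
  obtain ⟨u, hu, h2⟩ := h1 m
  obtain ⟨u', hu', h2'⟩ := h1' m
  refine ⟨u + u', Submodule.add_mem_sup hu hu', ?_⟩
  rw [add_comm N' N] at h2'
  convert add_mem h2 h2' using 1
  noncomm_ring

lemma PP_smul {c : I → I → ℤ} {i : I} {x : F I} (a : K) (hx : PP c i x) : PP c i (a • x) := by
  obtain ⟨N, U, hU, h⟩ := hx
  refine ⟨N, U, hU, fun m => ?_⟩
  obtain ⟨u, hu, h2⟩ := h m
  refine ⟨a • u, U.smul_mem _ hu, ?_⟩
  rw [mul_smul_comm, smul_mul_assoc, ← smul_sub]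
  exact Submodule.smul_mem _ _ h2

lemma PP_mul {c : I → I → ℤ} {i : I} {x y : F I} (hx : PP c i x) (hy : PP c i y) :
    PP c i (x * y) := by
  obtain ⟨N, U, hU, h⟩ := hx
  obtain ⟨N', U', hU', h'⟩ := hy
  refine ⟨N' + N, U * U', hU.mul hU', fun m => ?_⟩
  obtain ⟨u, hu, h2⟩ := h (m + N')
  obtain ⟨u', hu', h2'⟩ := h' m
  refine ⟨u * u', Submodule.mul_mem_mul hu hu', ?_⟩
  have h3 := add_mem (J_mul_right h2 y) (J_mul_left u h2')
  convert h3 using 1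
  rw [← add_assoc]
  noncomm_ring

lemma PP_one (c : I → I → ℤ) (i : I) : PP c i 1 := by
  refine ⟨0, Submodule.span K {1}, Submodule.fg_span_singleton _, fun m =>
    ⟨1, Submodule.mem_span_singleton_self _, ?_⟩⟩
  simp

lemma PP_self (c : I → I → ℤ) (i : I) : PP c i (θ i) := by
  refine ⟨0, Submodule.span K {θ i}, Submodule.fg_span_singleton _, fun m =>
    ⟨θ i, Submodule.mem_span_singleton_self _, ?_⟩⟩
  rw [add_zero, ← pow_succ, ← pow_succ']
  simp

lemma PP_theta {c : I → I → ℤ} (hc : CartanDatum c) (i j : I) : PP c i (θ j) := by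
  by_cases hij : i = j
  · subst hij; exact PP_self c i
  set d := dij c i j with hd
  set U := Submodule.span K ((fun k => θ i ^ k * θ j * θ i ^ (d - k)) '' (Finset.range (d + 1) : Set ℕ))
    with hU
  have hk : ∀ k ≤ d, θ i ^ k * θ j * θ i ^ (d - k) ∈ U := fun k hk =>
    Submodule.subset_span ⟨k, by simpa using Nat.lt_succ_of_le hk, rfl⟩
  have hs := serre_mem_J c hij
  set f : ℕ → K := fun a => (-1) ^ a * (qfact c i a)⁻¹ * (qfact c i (d + 1 - a))⁻¹ with hf
  have hs' : ∑ a ∈ Finset.range (d + 2), f a • (θ i ^ a * θ j * θ i ^ (d + 1 - a)) ∈ J c := by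
    convert hs using 1
    rw [serreElem]
    apply Finset.sum_congr rfl
    intro a _
    simp only [θdp, smul_mul_assoc, mul_smul_comm, smul_smul, hf]
    congr 1
    ring
  have hf0 : f (d + 1) ≠ 0 := by
    simp only [hf]
    refine mul_ne_zero (mul_ne_zero ?_ ?_) ?_
    · exact pow_ne_zero _ (by norm_num)
    · exact inv_ne_zero (qfact_ne c i hc _)
    · exact inv_ne_zero (qfact_ne c i hc _)
  have step : ∀ u ∈ U, ∃ u' ∈ U, θ i * u - u' * θ i ∈ J c := by
    intro u hu
    induction hu using Submodule.span_induction with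
    | zero => exact ⟨0, zero_mem _, by simp⟩
    | add x y _ _ hx hy =>
      obtain ⟨x', hx', h1⟩ := hx
      obtain ⟨y', hy', h2⟩ := hy
      refine ⟨x' + y', add_mem hx' hy', ?_⟩
      convert add_mem h1 h2 using 1
      noncomm_ring
    | smul a x _ hx =>
      obtain ⟨x', hx', h1⟩ := hx
      refine ⟨a • x', U.smul_mem _ hx', ?_⟩
      rw [mul_smul_comm, smul_mul_assoc, ← smul_sub]
      exact Submodule.smul_mem _ _ h1
    | mem x hx =>
      obtain ⟨k, hkd, rfl⟩ := hx
      simp only [Finset.coe_range, Set.mem_Iio] at hkd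
      dsimp only
      rcases Nat.lt_or_ge k d with h | h
      · refine ⟨_, hk (k + 1) h, ?_⟩
        have : d - k = (d - (k + 1)) + 1 := by omega
        rw [this, pow_succ' (θ i) k, pow_succ (θ i) (d - (k + 1))]
        simp only [mul_assoc, sub_self, zero_mem]
      · obtain rfl : k = d := by omega
        refine ⟨-(f (d + 1))⁻¹ • ∑ a ∈ Finset.range (d + 1), f a • (θ i ^ a * θ j * θ i ^ (d - a)),
          ?_, ?_⟩
        · exact U.smul_mem _ (U.sum_mem fun a ha => U.smul_mem _ (hk a (by
            have := Finset.mem_range.mp ha; omega)))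
        · have := Submodule.smul_mem _ (f (d + 1))⁻¹ hs'
          convert this using 1
          rw [Finset.sum_range_succ (n := d + 1), smul_add, smul_smul, inv_mul_cancel₀ hf0, one_smul,
            Nat.sub_self, Nat.sub_self, pow_zero, mul_one, mul_one, ← mul_assoc, ← pow_succ',
            smul_mul_assoc, neg_smul, sub_neg_eq_add, add_comm, Finset.sum_mul]
          congr 2
          apply Finset.sum_congr rfl
          intro a ha
          have : d + 1 - a = (d - a) + 1 := by have := Finset.mem_range.mp ha; omega
          rw [this, pow_succ, smul_mul_assoc]
          simp only [mul_assoc]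
  refine ⟨d, U, Submodule.fg_span (Set.Finite.image _ (Finset.finite_toSet _)), fun m => ?_⟩
  induction m with
  | zero => exact ⟨_, hk d le_rfl, by simp⟩
  | succ m ih =>
    obtain ⟨u, hu, h1⟩ := ih
    obtain ⟨u', hu', h2⟩ := step u hu
    refine ⟨u', hu', ?_⟩
    convert add_mem (J_mul_left (θ i) h1) (J_mul_right h2 (θ i ^ m)) using 1
    have : m + 1 + d = (m + d) + 1 := by omega
    rw [this, pow_succ', pow_succ' (θ i) m]
    noncomm_ring

lemma PP_all {c : I → I → ℤ} (hc : CartanDatum c) (i : I) (x : F I) : PP c i x := by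
  induction x using word_induction with
  | hadd x y hx hy => exact PP_add hx hy
  | hs a x hx => exact PP_smul a hx
  | hw w =>
    induction w with
    | nil => exact PP_one c i
    | cons j w ih => rw [word_cons]; exact PP_mul (PP_theta hc i j) ih

lemma exists_rel {c : I → I → ℤ} (hc : CartanDatum c) (i : I) (x : F I) : ∃ (N : ℕ) (f : ℕ → K),
    ∑ a ∈ Finset.range (N + 1), f a • (θ i ^ a * x * θ i ^ (N - a)) ∈ J c ∧
    ∃ a ≤ N, f a ≠ 0 := by
  obtain ⟨N, U, hU, h⟩ := PP_all hc i x
  choose u huU hu using h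
  have : Module.Finite K U := Module.Finite.iff_fg.mpr hU
  set d := Module.finrank K U with hd
  have hdep : ¬ LinearIndependent K (fun k : Fin (d + 1) => (⟨u k, huU k⟩ : U)) := by
    intro hli
    have := hli.fintype_card_le_finrank
    simp at this
    omega
  rw [Fintype.not_linearIndependent_iff] at hdep
  obtain ⟨g, hg, k0, hk0⟩ := hdep
  have hg' : ∑ k : Fin (d + 1), g k • u k = 0 := by
    have := congrArg (Submodule.subtype U) hg
    simpa using this
  set g' : ℕ → K := fun k => if hk : k < d + 1 then g ⟨k, hk⟩ else 0 with hgd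
  have hg'' : ∑ k ∈ Finset.range (d + 1), g' k • u k = 0 := by
    rw [← hg', Finset.sum_range]
    apply Finset.sum_congr rfl
    intro k _
    simp [hgd, k.2, Nat.lt_succ_iff.mp k.2]
  refine ⟨N + d, fun a => if a < N then 0 else g' (a - N), ?_, N + k0, by omega,
    by simpa [hgd, Nat.lt_succ_iff.mp k0.2] using hk0⟩
  rw [add_assoc, Finset.sum_range_add, Finset.sum_eq_zero, zero_add]
  · have h1 : ∑ k ∈ Finset.range (d + 1), g' k • ((θ i ^ (k + N) * x - u k * θ i ^ k) * θ i ^ (d - k)) ∈ J c :=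
      Submodule.sum_mem _ fun k _ => Submodule.smul_mem _ _ (J_mul_right (hu k) _)
    convert h1 using 1
    have h2 : ∑ k ∈ Finset.range (d + 1), g' k • (u k * θ i ^ d) = 0 := by
      have := congrArg (· * θ i ^ d) hg''
      simpa [Finset.sum_mul, smul_mul_assoc] using this
    rw [← sub_zero (∑ x_1 ∈ Finset.range (d + 1), _), ← h2, ← Finset.sum_sub_distrib]
    apply Finset.sum_congr rfl
    intro k hk
    have hk := Finset.mem_range.mp hk
    have e1 : N + d - (N + k) = d - k := by omega
    have e2 : θ i ^ d = θ i ^ k * θ i ^ (d - k) := by rw [← pow_add]; congr 1; omega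
    simp only [e1, Nat.not_lt.mpr (Nat.le_add_right N k), if_false, Nat.add_sub_cancel_left]
    rw [e2, ← smul_sub, sub_mul, add_comm k N, mul_assoc (u k)]
  · intro a ha
    simp [Finset.mem_range.mp ha]

/-- Step B -/
lemma stepB {c : I → I → ℤ} (hc : CartanDatum c) (i : I) {x : F I} (hx : x ∉ J c)
    (hD : D c i x ∈ J c) (hE : E c i x ∈ J c) {l : ℤ}
    (hu : tau c i x = (qvar ^ (-l)) • x) : l ≤ 0 := by
  by_contra hl
  obtain ⟨N, f, hf, a, ha, h0⟩ := exists_rel hc i x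
  exact h0 (rel hc i hx hD hE (not_le.mp hl) hu N f hf a ha)

end SerreRad

namespace SerreRad

set_option linter.unusedSectionVars false
set_option linter.unusedSimpArgs false

variable {I : Type} [DecidableEq I]

lemma tensor_sep {P : Type*} [AddCommGroup P] [Module K P] {Y : Type*} (φ : Y → P →ₗ[K] K)
    (hφ : ∀ p, (∀ y, φ y p = 0) → p = 0) (u : P ⊗[K] P)
    (hu : ∀ y y', LinearMap.mul' K K (TensorProduct.map (φ y) (φ y') u) = 0) : u = 0 := by
  set b := Module.Basis.ofVectorSpace K P
  obtain ⟨f, rfl⟩ := TensorProduct.eq_repr_basis_right b u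
  have hf : f = 0 := by
    ext k
    apply hφ
    intro y
    have h1 : f.sum (fun i m => φ y m • b i) = 0 := by
      apply hφ
      intro y'
      have := hu y y'
      rw [Finsupp.sum, map_sum, map_sum] at this
      rw [Finsupp.sum, map_sum, ← this]
      simp
    have h2 : b.repr (f.sum (fun i m => φ y m • b i)) k = φ y (f k) := by
      rw [Finsupp.sum, map_sum, Finsupp.finsetSum_apply]
      rw [Finset.sum_eq_single k]
      · rw [map_smul, Module.Basis.repr_self, Finsupp.smul_apply, Finsupp.single_eq_same, smul_eq_mul,
          mul_one]
      · intro l _ hl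
        rw [map_smul, Module.Basis.repr_self, Finsupp.smul_apply, Finsupp.single_eq_of_ne hl.symm,
          smul_zero]
      · intro hk
        rw [Finsupp.notMem_support_iff.mp hk]; simp
    rw [← h2, h1]; simp
  rw [hf]; simp

lemma ker_mkQ_tensor {V : Type*} [AddCommGroup V] [Module K V] (N : Submodule K V) :
    LinearMap.ker (TensorProduct.map N.mkQ N.mkQ) =
      LinearMap.range (N.subtype.lTensor V) ⊔ LinearMap.range (N.subtype.rTensor V) := by
  have hex : Function.Exact N.subtype N.mkQ := by
    rw [LinearMap.exact_iff]; simp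
  exact TensorProduct.map_ker hex N.mkQ_surjective hex N.mkQ_surjective

/-- convolution with the antipode -/
def T (c : I → I → ℤ) : F I ⊗[K] F I →ₗ[K] F I :=
  LinearMap.mul' K (F I) ∘ₗ (S c).rTensor (F I)

@[simp] lemma T_tmul (c : I → I → ℤ) (x y : F I) : T c (x ⊗ₜ y) = S c x * y := by simp [T]

lemma T_r_word {c : I → I → ℤ} {r : F I →ₗ[K] F I ⊗[K] F I} {B : F I →ₗ[K] F I →ₗ[K] K}
    (h : Data c r B) (w : List I) : T c (r (word w)) = if w = [] then 1 else 0 := by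
  induction w using List.reverseRecOn with
  | nil => rw [word_nil, h.r1]; simp
  | append_singleton w j ih =>
    have e1 : ∀ z : F I ⊗[K] F I, T c (TensorProduct.map (LinearMap.mulRight K (θ j))
        (tau c j).toLinearMap z) = -(θ j * tau c j (T c z)) := by
      intro z
      induction z using TensorProduct.induction_on with
      | zero => simp
      | add x y hx hy => simp only [map_add, hx, hy, mul_add, neg_add]
      | tmul x y =>
        simp only [TensorProduct.map_tmul, LinearMap.mulRight_apply, AlgHom.toLinearMap_apply,
          T_tmul, map_mul]
        rw [S_mul_theta c h.hc.1, S_tau]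
        simp only [mul_assoc, neg_mul]
    have e2 : ∀ z : F I ⊗[K] F I, T c (TensorProduct.map LinearMap.id 
        (LinearMap.mulRight K (θ j)) z) = T c z * θ j := by
      intro z
      induction z using TensorProduct.induction_on with
      | zero => simp
      | add x y hx hy => simp only [map_add, hx, hy, add_mul]
      | tmul x y => simp [mul_assoc]
    rw [word_append, word_singleton, h.rmul, map_add, e1, e2, ih]
    split_ifs with h1 h2 h2
    · simp at h2
    · simp
    · simp at h2
    · simp

lemma S_theta_mul (c : I → I → ℤ) (x : F I) (j : I) :
    S c (θ j * x) = -(S c (tau c j x) * θ j) := by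
  induction x using word_induction with
  | hadd x y hx hy => simp only [mul_add, map_add, hx, hy, add_mul, neg_add]
  | hs a x hx => simp only [mul_smul_comm, map_smul, hx, smul_mul_assoc, smul_neg]
  | hw w =>
    rw [tau_word, map_smul, ← word_cons, S, onWords_word, onWords_word]
    simp only [ex, List.reverse_cons, word_append, word_singleton, List.length_cons, smul_smul,
      smul_mul_assoc]
    rw [← neg_smul]
    congr 1
    rw [neg_add, zpow_add₀ qvar_ne]
    ring

lemma lp_perm (c : I → I → ℤ) (k : I) {v w : List I} (h : v.Perm w) : lp c k v = lp c k w :=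
  (h.map _).sum_eq

lemma ex_perm (c : I → I → ℤ) (hs : ∀ i j, c i j = c j i) {v w : List I} (h : v.Perm w) :
    ex c v = ex c w := by
  have h1 := two_ex c hs v
  have h2 := two_ex c hs w
  have h3 : (v.map fun i => c i i).sum = (w.map fun i => c i i).sum := (h.map _).sum_eq
  have h4 : (v.map fun i => lp c i v).sum = (w.map fun i => lp c i w).sum := by
    simp only [lp_perm c _ h]
    exact (h.map _).sum_eq
  omega

lemma S_Wt (c : I → I → ℤ) (hs : ∀ i j, c i j = c j i) (w : List I) {x : F I}
    (hx : x ∈ Wt (w : Multiset I)) :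
    S c x = ((-1) ^ w.length * qvar ^ (-(ex c w))) • sg x := by
  induction hx using Submodule.span_induction with
  | zero => simp
  | add x y _ _ hx hy => rw [map_add, map_add, hx, hy, smul_add]
  | smul a x _ hx => rw [map_smul, map_smul, hx, smul_comm]
  | mem x hx =>
    obtain ⟨v, hv, rfl⟩ := hx
    have hp : v.Perm w := Multiset.coe_eq_coe.mp hv
    rw [S, onWords_word, sg_word, ex_perm c hs hp, hp.length_eq]

lemma tau_Wt (c : I → I → ℤ) (k : I) (w : List I) {x : F I}
    (hx : x ∈ Wt (w : Multiset I)) : tau c k x = (qvar ^ (-(lp c k w))) • x := by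
  induction hx using Submodule.span_induction with
  | zero => simp
  | add x y _ _ hx hy => rw [map_add, hx, hy, smul_add]
  | smul a x _ hx => rw [map_smul, hx, smul_comm]
  | mem x hx =>
    obtain ⟨v, hv, rfl⟩ := hx
    have hp : v.Perm w := Multiset.coe_eq_coe.mp hv
    rw [tau_word, lp_perm c k hp]

lemma word_replicate (i : I) (n : ℕ) : word (List.replicate n i) = θ i ^ n := by
  induction n with
  | zero => simp
  | succ n ih => rw [List.replicate_succ, word_cons, ih, pow_succ']

lemma serre_Wt (c : I → I → ℤ) (i j : I) :
    serreElem c i j ∈ Wt ((List.replicate (dij c i j + 1) i ++ [j] : List I) : Multiset I) := by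
  rw [serreElem]
  refine Submodule.sum_mem _ fun a ha => Submodule.smul_mem _ _ ?_
  rw [θdp, θdp, smul_mul_assoc, smul_mul_assoc, mul_smul_comm]
  refine Submodule.smul_mem _ _ (Submodule.smul_mem _ _ (Submodule.subset_span
    ⟨List.replicate a i ++ [j] ++ List.replicate (dij c i j + 1 - a) i, ?_, ?_⟩))
  · rw [Multiset.coe_eq_coe]
    have ha := Finset.mem_range.mp ha
    have : dij c i j + 1 = a + (dij c i j + 1 - a) := by omega
    conv_rhs => rw [this, List.replicate_add]
    rw [List.append_assoc, List.append_assoc]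
    exact List.Perm.append_left _ List.perm_append_comm
  · simp [word_replicate, mul_assoc]

lemma S_J {c : I → I → ℤ} (hc : CartanDatum c) {x : F I} (hx : x ∈ J c) : S c x ∈ J c := by
  have : J c ≤ (J c).comap (S c) := by
    refine J_le _ ?_ ?_ ?_
    · intro x y hy
      induction x using word_induction with
      | hadd x x' hx hx' => rw [add_mul]; exact add_mem hx hx'
      | hs a x hx => rw [smul_mul_assoc]; exact Submodule.smul_mem _ _ hx
      | hw w =>
        induction w with
        | nil => simpa using hy
        | cons j w ih =>
          rw [word_cons, mul_assoc, Submodule.mem_comap, S_theta_mul, S_tau]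
          exact neg_mem (J_mul_right (tau_J j ih) _)
    · intro x y hy
      induction y using word_induction with
      | hadd x x' hx hx' => rw [mul_add]; exact add_mem hx hx'
      | hs a x hx => rw [mul_smul_comm]; exact Submodule.smul_mem _ _ hx
      | hw w =>
        induction w using List.reverseRecOn with
        | nil => simpa using hy
        | append_singleton w j ih =>
          rw [word_append, word_singleton, ← mul_assoc, Submodule.mem_comap, S_mul_theta c hc.1, S_tau]
          exact neg_mem (J_mul_left _ (tau_J j ih))
    · intro i j hij
      rw [Submodule.mem_comap, S_Wt c hc.1 _ (serre_Wt c i j)]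
      exact Submodule.smul_mem _ _ (sg_J (serre_mem_J c hij))
  exact this hx

/-- span of words of length less than n -/
def W (I : Type) (n : ℕ) : Submodule K (F I) :=
  Submodule.span K {x | ∃ w : List I, w.length < n ∧ x = word w}

def R (I : Type) (n : ℕ) : Submodule K (F I ⊗[K] F I) :=
  Submodule.span K {x | ∃ u v : List I, u.length + v.length = n ∧ x = word u ⊗ₜ word v}

variable {c : I → I → ℤ} {r : F I →ₗ[K] F I ⊗[K] F I} {B : F I →ₗ[K] F I →ₗ[K] K}

lemma r_word_mem (h : Data c r B) (w : List I) : r (word w) ∈ R I w.length := by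
  induction w using List.reverseRecOn with
  | nil => rw [word_nil, h.r1]; exact Submodule.subset_span ⟨[], [], rfl, by simp⟩
  | append_singleton w j ih =>
    rw [word_append, word_singleton, h.rmul]
    refine add_mem ?_ ?_
    · have : R I w.length ≤ (R I (w ++ [j]).length).comap
          (TensorProduct.map (LinearMap.mulRight K (θ j)) (tau c j).toLinearMap) := by
        refine Submodule.span_le.mpr ?_
        rintro _ ⟨u, v, huv, rfl⟩
        simp only [SetLike.mem_coe, Submodule.mem_comap, TensorProduct.map_tmul,
          LinearMap.mulRight_apply, AlgHom.toLinearMap_apply, tau_word, TensorProduct.tmul_smul]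
        refine Submodule.smul_mem _ _ (Submodule.subset_span ⟨u ++ [j], v, ?_, by simp⟩)
        simp; omega
      exact this ih
    · have : R I w.length ≤ (R I (w ++ [j]).length).comap
          (TensorProduct.map LinearMap.id (LinearMap.mulRight K (θ j))) := by
        refine Submodule.span_le.mpr ?_
        rintro _ ⟨u, v, huv, rfl⟩
        refine Submodule.subset_span ⟨u, v ++ [j], ?_, by simp⟩
        simp; omega
      exact this ih

lemma r_Wt_mem (h : Data c r B) (w : List I) {x : F I} (hx : x ∈ Wt (w : Multiset I)) :
    r x ∈ R I w.length := by
  have : Wt (w : Multiset I) ≤ (R I w.length).comap r := by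
    refine Submodule.span_le.mpr ?_
    rintro _ ⟨v, hv, rfl⟩
    have hp : v.Perm w := Multiset.coe_eq_coe.mp hv
    rw [← hp.length_eq]
    exact r_word_mem h v
  exact this hx

lemma T_r_Wt (h : Data c r B) (w : List I) (hw : w ≠ []) {x : F I} (hx : x ∈ Wt (w : Multiset I)) :
    T c (r x) = 0 := by
  have : Wt (w : Multiset I) ≤ LinearMap.ker (T c ∘ₗ r) := by
    refine Submodule.span_le.mpr ?_
    rintro _ ⟨v, hv, rfl⟩
    have hp : v.Perm w := Multiset.coe_eq_coe.mp hv
    rw [SetLike.mem_coe, LinearMap.mem_ker, LinearMap.comp_apply, T_r_word h, if_neg]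
    rintro rfl
    exact hw hp.nil_eq.symm
  exact this hx

lemma red_mem (h : Data c r B) {n : ℕ} (hn : n ≠ 0) {z : F I ⊗[K] F I} (hz : z ∈ R I n) :
    z - TensorProduct.rid K _ ((B.flip 1).lTensor _ z) ⊗ₜ 1
      - 1 ⊗ₜ TensorProduct.lid K _ ((B.flip 1).rTensor _ z) ∈
    LinearMap.range (TensorProduct.map (W I n).subtype (W I n).subtype) := by
  induction hz using Submodule.span_induction with
  | zero => simp
  | add x y _ _ hx hy =>
    convert add_mem hx hy using 1
    simp only [map_add, TensorProduct.add_tmul, TensorProduct.tmul_add]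
    abel
  | smul a x _ hx =>
    convert Submodule.smul_mem _ a hx using 1
    simp only [map_smul, TensorProduct.smul_tmul', TensorProduct.tmul_smul, smul_sub]
  | mem x hx =>
    obtain ⟨u, v, huv, rfl⟩ := hx
    simp only [LinearMap.lTensor_tmul, LinearMap.rTensor_tmul, TensorProduct.rid_tmul,
      TensorProduct.lid_tmul, LinearMap.flip_apply, eps_word h]
    by_cases hu : u = []
    · have hv : v ≠ [] := by
        rintro rfl; subst hu; simp at huv; omega
      simp [hu, hv]
    · by_cases hv : v = []
      · simp [hu, hv]
      · have h1 := List.length_pos_iff.mpr hu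
        have h2 := List.length_pos_iff.mpr hv
        simp only [hu, hv, if_false, zero_smul, TensorProduct.zero_tmul, TensorProduct.tmul_zero,
          sub_zero]
        refine ⟨⟨word u, Submodule.subset_span ⟨u, by omega, rfl⟩⟩ ⊗ₜ
          ⟨word v, Submodule.subset_span ⟨v, by omega, rfl⟩⟩, by simp⟩

lemma A_core (h : Data c r B) {n : ℕ} (hW : ∀ x ∈ W I n, x ∈ LinearMap.ker B → x ∈ J c)
    {t : F I ⊗[K] F I} (ht : t ∈ LinearMap.range (TensorProduct.map (W I n).subtype (W I n).subtype))
    (ht0 : ∀ y y', BB B t (y ⊗ₜ y') = 0) : T c t ∈ J c := by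
  obtain ⟨z, rfl⟩ := ht
  set N : Submodule K (W I n) := (J c).comap (W I n).subtype with hN
  have hle : ∀ y, N ≤ LinearMap.ker (B.flip y ∘ₗ (W I n).subtype) := by
    intro y a ha
    have := J_le_ker h ha
    rw [LinearMap.mem_ker] at this
    simp only [LinearMap.mem_ker, LinearMap.comp_apply, LinearMap.flip_apply, this,
      LinearMap.zero_apply]
  have hu := tensor_sep (P := (W I n) ⧸ N) (fun y : F I => N.liftQ (B.flip y ∘ₗ (W I n).subtype) (hle y)) ?_
    (TensorProduct.map N.mkQ N.mkQ z) ?_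
  · have hz : z ∈ LinearMap.ker (TensorProduct.map N.mkQ N.mkQ) := hu
    rw [ker_mkQ_tensor N] at hz
    have hJ : LinearMap.range (N.subtype.lTensor (W I n)) ⊔ LinearMap.range (N.subtype.rTensor (W I n))
        ≤ (J c).comap (T c ∘ₗ TensorProduct.map (W I n).subtype (W I n).subtype) := by
      refine sup_le ?_ ?_
      · rintro _ ⟨a, rfl⟩
        induction a using TensorProduct.induction_on with
        | zero => simp
        | add x y hx hy => rw [map_add]; exact add_mem hx hy
        | tmul x y => 
          rw [LinearMap.lTensor_tmul, Submodule.mem_comap, LinearMap.comp_apply,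
            TensorProduct.map_tmul, T_tmul]
          exact J_mul_left _ y.2
      · rintro _ ⟨a, rfl⟩
        induction a using TensorProduct.induction_on with
        | zero => simp
        | add x y hx hy => rw [map_add]; exact add_mem hx hy
        | tmul x y => 
          rw [LinearMap.rTensor_tmul, Submodule.mem_comap, LinearMap.comp_apply,
            TensorProduct.map_tmul, T_tmul]
          exact J_mul_right (S_J h.hc x.2) _
    exact hJ hz
  · intro p hp
    obtain ⟨w, rfl⟩ := N.mkQ_surjective p
    rw [Submodule.mkQ_apply, Submodule.Quotient.mk_eq_zero]
    apply hW _ w.2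
    rw [LinearMap.mem_ker]
    exact LinearMap.ext fun y => by simpa using hp y
  · intro y y'
    rw [← ht0 y y']
    clear ht0
    induction z using TensorProduct.induction_on with
    | zero => simp
    | add a b ha hb => simp only [map_add, LinearMap.add_apply, ha, hb]
    | tmul a b => 
      simp only [TensorProduct.map_tmul, BB_tmul]
      simp

lemma stepA (h : Data c r B) {n : ℕ} (hW : ∀ x ∈ W I n, x ∈ LinearMap.ker B → x ∈ J c)
    (hn : n ≠ 0) (w : List I) (hw : w.length = n) {x : F I} (hx : x ∈ Wt (w : Multiset I))
    (hk : x ∈ LinearMap.ker B) : S c x + x ∈ J c := by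
  have hr := r_Wt_mem h w hx
  rw [hw] at hr
  have h1 := red_mem h hn hr
  rw [r_eps h, r_eps' h] at h1
  have h2 := A_core h hW h1 ?_
  · rw [map_sub, map_sub, T_r_Wt h w (by rintro rfl; simp at hw; omega) hx, T_tmul, T_tmul, S_one,
      mul_one, one_mul] at h2
    convert neg_mem h2 using 1
    abel
  · intro y y'
    rw [LinearMap.mem_ker] at hk
    rw [map_sub, map_sub, LinearMap.sub_apply, LinearMap.sub_apply, ← h.hB.2.2.1, BB_tmul, BB_tmul, hk]
    simp

lemma proj_W {n : ℕ} {x : F I} (hx : x ∈ W I n) (v : List I) (hv : n ≤ v.length) :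
    proj (v : Multiset I) x = 0 := by
  have : W I n ≤ LinearMap.ker (proj (v : Multiset I)) := by
    refine Submodule.span_le.mpr ?_
    rintro _ ⟨u, hu, rfl⟩
    rw [SetLike.mem_coe, LinearMap.mem_ker, proj, onWords_word, if_neg]
    intro huv
    have := (Multiset.coe_eq_coe.mp huv).length_eq
    omega
  exact this hx

lemma D_Wt_mem (h : Data c r B) (k : I) (w : List I) {x : F I} (hx : x ∈ Wt (w : Multiset I)) :
    D c k x ∈ W I w.length := by
  have : Wt (w : Multiset I) ≤ (W I w.length).comap (D c k) := by
    refine Submodule.span_le.mpr ?_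
    rintro _ ⟨v, hv, rfl⟩
    have hp : v.Perm w := Multiset.coe_eq_coe.mp hv
    refine Submodule.span_mono ?_ (D_word_mem h k v)
    rintro _ ⟨u, hu, rfl⟩
    refine ⟨u, ?_, rfl⟩
    have := congrArg Multiset.card hu
    simp at this
    have := hp.length_eq
    omega
  exact this hx

lemma main_aux (h : Data c r B) (n : ℕ) : ∀ w : List I, w.length = n → ∀ x ∈ Wt (w : Multiset I),
    x ∈ LinearMap.ker B → x ∈ J c := by
  induction n using Nat.strong_induction_on with
  | _ n ih =>
  have hW : ∀ x ∈ W I n, x ∈ LinearMap.ker B → x ∈ J c := by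
    intro x hx hk
    apply mem_of_proj_mem
    intro ν
    obtain ⟨v, rfl⟩ := Quot.exists_rep ν
    rcases Nat.lt_or_ge v.length n with hv | hv
    · exact ih _ hv v rfl _ (proj_mem _ _) (proj_ker h hk _)
    · have := proj_W hx v hv
      change proj (v : Multiset I) x ∈ J c
      rw [this]; exact zero_mem _
  intro w hw x hx hk
  by_cases hn : n = 0
  · subst hn
    obtain rfl : w = [] := List.length_eq_zero_iff.mp hw
    have hle : Wt (([] : List I) : Multiset I) ≤ Submodule.span K {1} := by
      refine Submodule.span_mono ?_
      rintro _ ⟨v, hv, rfl⟩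
      have hp : v.Perm [] := Multiset.coe_eq_coe.mp hv
      rw [hp.eq_nil]; simp
    obtain ⟨a, rfl⟩ := Submodule.mem_span_singleton.mp (hle hx)
    rw [LinearMap.mem_ker] at hk
    have := congrArg (fun f => f 1) hk
    simp only [map_smul, LinearMap.smul_apply, h.hB.1, LinearMap.zero_apply, smul_eq_mul, mul_one] at this
    rw [this, zero_smul]; exact zero_mem _
  by_contra hxJ
  have hA := stepA h hW hn w hw hx hk
  rw [S_Wt c h.hc.1 w hx] at hA
  set s : K := (-1) ^ w.length * qvar ^ (-(ex c w)) with hs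
  have hs0 : s ≠ 0 := mul_ne_zero (pow_ne_zero _ (by norm_num)) (zpow_ne_zero _ qvar_ne)
  have hA' := sg_J hA
  rw [map_add, map_smul, sg_sg] at hA'
  have hex : ex c w = 0 := by
    have h1 : (1 - s ^ 2) • x ∈ J c := by
      convert sub_mem hA (Submodule.smul_mem _ s hA') using 1
      rw [smul_add, smul_smul, sub_smul, one_smul, pow_two]
      abel
    have h2 : 1 - s ^ 2 = 0 := by
      by_contra h0
      exact hxJ ((Submodule.smul_mem_iff _ h0).mp h1)
    have h3 : qvar ^ (-(ex c w) * 2) = 1 := by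
      rw [zpow_mul]
      have h4 : s ^ 2 = 1 := by linear_combination -h2
      rw [hs, mul_pow, ← pow_mul, mul_comm w.length, pow_mul] at h4
      simp only [even_two, Even.neg_pow, one_pow, one_mul] at h4
      exact_mod_cast h4
    have := qvar_zpow_eq_one h3
    omega
  have hD : ∀ i, D c i x ∈ J c := by
    intro i
    have h1 := D_Wt_mem h i w hx
    rw [hw] at h1
    exact hW _ h1 (D_ker h hk i)
  have hE : ∀ i, E c i x ∈ J c := by
    intro i
    have h1 := D_J h.hc i hA
    rw [map_add, map_smul] at h1
    have h2 := sub_mem h1 (hD i)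
    rw [add_sub_cancel_right] at h2
    exact sg_J ((Submodule.smul_mem_iff _ hs0).mp h2)
  have hl : ∀ i, lp c i w ≤ 0 := fun i => stepB h.hc i hxJ (hD i) (hE i) (tau_Wt c i w hx)
  have h2 := two_ex c h.hc.1 w
  rw [hex] at h2
  have h3 : (w.map fun i => lp c i w).sum ≤ 0 := by
    have := List.sum_le_sum (l := w) (f := fun i => lp c i w) (g := fun _ => 0) fun i _ => hl i
    simpa using this
  have h4 : 0 < (w.map fun i => c i i).sum := by
    apply List.sum_pos
    · intro a ha
      obtain ⟨i, _, rfl⟩ := List.mem_map.mp ha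
      exact (h.hc.2.1 i).1
    · intro h0
      rw [List.map_eq_nil_iff] at h0
      subst h0; simp at hw; omega
  omega

lemma ker_eq (h : Data c r B) : LinearMap.ker B = J c := by
  apply le_antisymm _ (J_le_ker h)
  intro x hx
  apply mem_of_proj_mem
  intro ν
  obtain ⟨v, rfl⟩ := Quot.exists_rep ν
  exact main_aux h _ v rfl _ (proj_mem _ _) (proj_ker h hx _)

end SerreRad

/-- the radical of an admissible bilinear form equals the two-sided ideal
generated by the quantum Serre elements. -/
theorem radical_eq_serre_ideal {I : Type} [Fintype I] [DecidableEq I]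
    (c : I → I → ℤ) (hc : CartanDatum c)
    (m : F I ⊗[K] F I →ₗ[K] F I ⊗[K] F I →ₗ[K] F I ⊗[K] F I)
    (hm : IsTwistedMul c m)
    (r : F I →ₗ[K] F I ⊗[K] F I) (hr : IsComult m r)
    (B : F I →ₗ[K] F I →ₗ[K] K) (hB : Admissible c r B) :
    {x : F I | ∀ y : F I, B x y = 0} =
      (TwoSidedIdeal.span {x : F I | ∃ i j : I, i ≠ j ∧ x = serreElem c i j} :
        Set (F I)) := by
  have h := SerreRad.Data.mk' hc hm hr hB
  have hk := SerreRad.ker_eq h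
  ext x
  have h1 : x ∈ LinearMap.ker B ↔ x ∈ SerreRad.J c := by rw [hk]
  rw [SerreRad.mem_J, LinearMap.mem_ker] at h1
  refine Iff.trans ?_ h1
  rw [Set.mem_setOf_eq]
  constructor
  · intro hx
    exact LinearMap.ext hx
  · intro hx y
    rw [hx, LinearMap.zero_apply]
end
end

section
/- Let n ≥ 2. Let e'_{n-1} : P → P be the analogue of e_{n-1} built on the last n-1 variables: e'_{n-1}(f) = x_2^{n-2} x_3^{n-3} ⋯ x_{n-1} · ∂'(n-1)(f), where ∂'(n-1) is the composite of divided differences along the reduced word (s_2)(s_3 s_2)⋯(s_{n-1}⋯s_2) of the longest element of the symmetric group on {2,…,n}; and let e''_{n-1} : P → P be the analogue built on the first n-1 variables: e''_{n-1}(f) = x_1^{n-2} x_2^{n-3} ⋯ x_{n-2} · ∂''(n-1)(f), where ∂''(n-1) is the composite along the reduced word (s_1)(s_2 s_1)⋯(s_{n-2}⋯s_1) of the longest element of the symmetric group on {1,…,n-1}. Then e_n ∘ e'_{n-1} = e_n and e_n ∘ e''_{n-1} = e_n as operators on P. -/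
noncomputable section

open MvPolynomial

/-- The reduced word (s_1)(s_2 s_1)(s_3 s_2 s_1)⋯(s_{n-1}⋯s_1) of the longest element of
the symmetric group S_n, written 0-indexed (the simple transposition s_{k+1} corresponds
to the index k). -/
def nilWord (n : ℕ) : List ℕ :=
  (List.range (n - 1)).flatMap fun t => (List.range (t + 1)).reverse

/-- The composite ∂(n) = ∂_{i_1} ∘ ⋯ ∘ ∂_{i_N} of the divided difference operators D
along the reduced word (s_1)(s_2 s_1)⋯(s_{n-1}⋯s_1) of the longest element of S_n. -/
def longOp {n : ℕ} (D : ℕ → MvPolynomial (Fin n) ℤ →ₗ[ℤ] MvPolynomial (Fin n) ℤ) :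
    MvPolynomial (Fin n) ℤ →ₗ[ℤ] MvPolynomial (Fin n) ℤ :=
  (nilWord n).foldr (fun k acc => (D k).comp acc) LinearMap.id

/-- The staircase monomial x_1^{n-1} x_2^{n-2} ⋯ x_{n-1} (variables 0-indexed). -/
def staircase (n : ℕ) : MvPolynomial (Fin n) ℤ :=
  ∏ i : Fin n, X i ^ (n - 1 - (i : ℕ))

/-- D k is, for each k with k+1 ≤ n-1 (0-indexed: k+1 < n), the divided difference
operator ∂_{k+1}, uniquely determined by (x_{k+1} - x_{k+2})·∂_{k+1}(f) = f - s_{k+1}(f). -/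
def IsDDiff {n : ℕ} (D : ℕ → MvPolynomial (Fin n) ℤ →ₗ[ℤ] MvPolynomial (Fin n) ℤ) : Prop :=
  ∀ (k : ℕ) (hk : k + 1 < n) (f : MvPolynomial (Fin n) ℤ),
    (X (⟨k, Nat.lt_of_succ_lt hk⟩ : Fin n) - X ⟨k + 1, hk⟩) * D k f =
      f - rename (Equiv.swap (⟨k, Nat.lt_of_succ_lt hk⟩ : Fin n) ⟨k + 1, hk⟩) f

/-- The reduced word (s_2)(s_3 s_2)⋯(s_{n-1}⋯s_2) of the longest element of the symmetric
group on the last n-1 letters, 0-indexed. -/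
def nilWord' (n : ℕ) : List ℕ :=
  (List.range (n - 2)).flatMap fun t => ((List.range (t + 1)).reverse.map (· + 1))

/-- ∂'(n-1): composite of divided differences along nilWord' n. -/
def longOp' {n : ℕ} (D : ℕ → MvPolynomial (Fin n) ℤ →ₗ[ℤ] MvPolynomial (Fin n) ℤ) :
    MvPolynomial (Fin n) ℤ →ₗ[ℤ] MvPolynomial (Fin n) ℤ :=
  (nilWord' n).foldr (fun k acc => (D k).comp acc) LinearMap.id

/-- The staircase monomial x_2^{n-2} x_3^{n-3} ⋯ x_{n-1} on the last n-1 variables. -/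
def staircase' (n : ℕ) : MvPolynomial (Fin n) ℤ :=
  ∏ i : Fin n, X i ^ (if (i : ℕ) = 0 then 0 else n - 1 - (i : ℕ))

/-- ∂''(n-1): composite of divided differences along the reduced word
(s_1)(s_2 s_1)⋯(s_{n-2}⋯s_1) of the longest element of the symmetric group on the
first n-1 letters. -/
def longOp'' {n : ℕ} (D : ℕ → MvPolynomial (Fin n) ℤ →ₗ[ℤ] MvPolynomial (Fin n) ℤ) :
    MvPolynomial (Fin n) ℤ →ₗ[ℤ] MvPolynomial (Fin n) ℤ :=
  (nilWord (n - 1)).foldr (fun k acc => (D k).comp acc) LinearMap.id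

/-- The staircase monomial x_1^{n-2} x_2^{n-3} ⋯ x_{n-2} on the first n-1 variables. -/
def staircase'' (n : ℕ) : MvPolynomial (Fin n) ℤ :=
  ∏ i : Fin n, X i ^ (n - 2 - (i : ℕ))

namespace NilAux

structure NilRel {R : Type*} [Ring R] (D : ℕ → R) : Prop where
  sq : ∀ k, D k * D k = 0
  comm : ∀ i j, i + 1 < j → D i * D j = D j * D i
  braid : ∀ k, D k * D (k + 1) * D k = D (k + 1) * D k * D (k + 1)

section words
variable {R : Type*} [Ring R]

def cc (D : ℕ → R) : ℕ → R
  | 0 => 1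
  | m + 1 => D m * cc D m

def dd (D : ℕ → R) : ℕ → R
  | 0 => 1
  | m + 1 => dd D m * D m

def WW (D : ℕ → R) : ℕ → R
  | 0 => 1
  | m + 1 => WW D m * cc D m

variable {D : ℕ → R}

lemma NilRel.shift (h : NilRel D) : NilRel (fun k => D (k + 1)) where
  sq k := h.sq _
  comm i j hij := h.comm _ _ (by omega)
  braid k := h.braid _

lemma cc_comm (h : NilRel D) (m j : ℕ) (hj : m < j) : cc D m * D j = D j * cc D m := by
  induction m with
  | zero => simp [cc]
  | succ m ih =>
    rw [cc, mul_assoc, ih (by omega), ← mul_assoc, h.comm m j (by omega), mul_assoc]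

lemma dd_comm (h : NilRel D) (m j : ℕ) (hj : m < j) : dd D m * D j = D j * dd D m := by
  induction m with
  | zero => simp [dd]
  | succ m ih =>
    rw [dd, mul_assoc, h.comm m j (by omega), ← mul_assoc, ih (by omega), mul_assoc]

lemma cc_D (h : NilRel D) (m k : ℕ) (hk : k + 1 < m) :
    cc D m * D (k + 1) = D k * cc D m := by
  induction m with
  | zero => omega
  | succ m ih =>
    rcases Nat.lt_or_ge (k + 1) m with h1 | h1
    · rw [cc, mul_assoc, ih h1, ← mul_assoc, ← h.comm k m h1, mul_assoc]
    · obtain rfl : m = k + 1 := by omega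
      rw [cc, cc, mul_assoc, mul_assoc, cc_comm h k (k + 1) (by omega)]
      simp only [← mul_assoc]
      rw [h.braid]

lemma D_dd (h : NilRel D) (m k : ℕ) (hk : k + 1 < m) :
    D (k + 1) * dd D m = dd D m * D k := by
  induction m with
  | zero => omega
  | succ m ih =>
    rcases Nat.lt_or_ge (k + 1) m with h1 | h1
    · rw [dd, ← mul_assoc, ih h1, mul_assoc, h.comm k m h1, mul_assoc]
    · obtain rfl : m = k + 1 := by omega
      rw [dd, dd, ← mul_assoc, ← mul_assoc, ← dd_comm h k (k + 1) (by omega)]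
      simp only [mul_assoc]
      have := h.braid k
      simp only [mul_assoc] at this
      rw [this]

lemma cc_cc (h : NilRel D) (m j : ℕ) (hj : j < m) :
    cc D m * cc (fun k => D (k + 1)) j = cc D j * cc D m := by
  induction j with
  | zero => simp [cc]
  | succ j ih =>
    rw [cc, cc, ← mul_assoc, cc_D h m j hj, mul_assoc, ih (by omega), mul_assoc]

lemma cc_WW (h : NilRel D) (m j : ℕ) (hj : j ≤ m) :
    cc D m * WW (fun k => D (k + 1)) j = WW D j * cc D m := by
  induction j with
  | zero => simp [WW]
  | succ j ih =>
    rw [WW, WW, ← mul_assoc, ih (by omega), mul_assoc, cc_cc h m j hj, mul_assoc]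

lemma WW_succ' (h : NilRel D) (m : ℕ) :
    WW D (m + 1) = cc D m * WW (fun k => D (k + 1)) m := by
  rw [cc_WW h m m le_rfl, WW]

lemma WW_succ (h : NilRel D) (m : ℕ) : WW D (m + 1) = dd D m * WW D m := by
  induction m with
  | zero => simp [WW, dd, cc]
  | succ m ih =>
    rw [WW, ih, mul_assoc, ← cc_WW h (m + 1) m (by omega), cc, dd, ← ih, WW_succ' h m]
    simp only [mul_assoc]

lemma D0_dd (h : NilRel D) (m : ℕ) : D 0 * dd D (m + 1) = 0 := by
  induction m with
  | zero => simp [dd, h.sq]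
  | succ m ih => rw [dd, ← mul_assoc, ih, zero_mul]

lemma D_WW (h : NilRel D) (m k : ℕ) (hk : k + 1 < m) : D k * WW D m = 0 := by
  induction m generalizing k with
  | zero => omega
  | succ m ih =>
    rw [WW_succ h, ← mul_assoc]
    cases k with
    | zero =>
      obtain ⟨m, rfl⟩ : ∃ m', m = m' + 1 := ⟨m - 1, by omega⟩
      rw [D0_dd h, zero_mul]
    | succ k =>
      rw [D_dd h m k (by omega), mul_assoc, ih k (by omega), mul_zero]

lemma cc_congr {D' : ℕ → R} (m : ℕ) (H : ∀ k < m, D k = D' k) : cc D m = cc D' m := by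
  induction m with
  | zero => rfl
  | succ m ih => rw [cc, cc, ih (fun k hk => H k (by omega)), H m (by omega)]

lemma WW_congr {D' : ℕ → R} (m : ℕ) (H : ∀ k, k + 1 < m → D k = D' k) : WW D m = WW D' m := by
  induction m with
  | zero => rfl
  | succ m ih =>
    rw [WW, WW, ih (fun k hk => H k (by omega)), cc_congr m (fun k hk => H k (by omega))]

lemma cc_list (D : ℕ → R) (m : ℕ) : ((List.range m).reverse.map D).prod = cc D m := by
  induction m with
  | zero => simp [cc]
  | succ m ih => 
    rw [List.range_succ, List.reverse_append, List.map_append, List.prod_append, ih]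
    simp [cc]

lemma WW_list (D : ℕ → R) (m : ℕ) : ((((List.range m).flatMap
    fun t => (List.range (t + 1)).reverse)).map D).prod = WW D (m + 1) := by
  induction m with
  | zero => simp [WW, cc]
  | succ m ih =>
    rw [List.range_succ, List.flatMap_append, List.map_append, List.prod_append, ih]
    rw [List.flatMap_singleton, cc_list]
    rfl

end words

section act
variable {P : Type*} [CommRing P] {D : ℕ → Module.End ℤ P}

def EE (x : ℕ → P) : ℕ → P
  | 0 => 1
  | m + 1 => EE x m * x m

def SS (x : ℕ → P) : ℕ → P
  | 0 => 1
  | m + 1 => SS x m * EE x m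

structure Act (D : ℕ → Module.End ℤ P) (x : ℕ → P) (N : ℕ) : Prop where
  rel : NilRel D
  leib : ∀ k f g, D k g = 0 → D k (f * g) = D k f * g
  one : ∀ k, D k 1 = 0
  far : ∀ k j, j ≠ k → j ≠ k + 1 → D k (x j) = 0
  near : ∀ k, D k (x k * x (k + 1)) = 0
  self : ∀ k, k + 1 < N → D k (x k) = 1

variable {x : ℕ → P} {N : ℕ}

lemma Act.leib' (h : Act D x N) (k : ℕ) (f g : P) (hf : D k f = 0) :
    D k (f * g) = f * D k g := by
  rw [mul_comm, h.leib k g f hf, mul_comm]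

lemma Act.EE_ge (h : Act D x N) (k m : ℕ) (hm : m ≤ k) : D k (EE x m) = 0 := by
  induction m with
  | zero => exact h.one k
  | succ m ih =>
    rw [EE, h.leib' _ _ _ (ih (by omega)), h.far k m (by omega) (by omega), mul_zero]

lemma Act.EE_lt (h : Act D x N) (k m : ℕ) (hm : k + 1 < m) : D k (EE x m) = 0 := by
  induction m with
  | zero => omega
  | succ m ih =>
    rcases Nat.lt_or_ge (k + 1) m with h1 | h1
    · rw [EE, h.leib' _ _ _ (ih h1), h.far k m (by omega) (by omega), mul_zero]
    · obtain rfl : m = k + 1 := by omega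
      rw [EE, EE, mul_assoc, h.leib' _ _ _ (h.EE_ge k k le_rfl), h.near, mul_zero]

lemma Act.EE_self (h : Act D x N) (k : ℕ) (hk : k + 1 < N) : D k (EE x (k + 1)) = EE x k := by
  rw [EE, h.leib' _ _ _ (h.EE_ge k k le_rfl), h.self k hk, mul_one]

lemma Act.dd_EE (h : Act D x N) (m : ℕ) (hm : m < N) : dd D m (EE x m) = 1 := by
  induction m with
  | zero => simp [dd, EE]
  | succ m ih =>
    rw [dd, Module.End.mul_apply, h.EE_self m hm, ih (by omega)]

lemma Act.cc_mul (h : Act D x N) (m : ℕ) (f g : P) (hg : ∀ k < m, D k g = 0) :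
    cc D m (f * g) = cc D m f * g := by
  induction m with
  | zero => simp [cc]
  | succ m ih =>
    rw [cc, Module.End.mul_apply, Module.End.mul_apply, ih (fun k hk => hg k (by omega)),
      h.leib _ _ _ (hg m (by omega))]

lemma Act.WW_mul (h : Act D x N) (m : ℕ) (f g : P) (hg : ∀ k, k + 1 < m → D k g = 0) :
    WW D m (f * g) = WW D m f * g := by
  induction m generalizing f with
  | zero => simp [WW]
  | succ m ih =>
    rw [WW, Module.End.mul_apply, Module.End.mul_apply,
      h.cc_mul m f g (fun k hk => hg k (by omega)), ih _ (fun k hk => hg k (by omega))]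

lemma Act.WW_SS (h : Act D x N) (m : ℕ) (hm : m ≤ N) : WW D m (SS x m) = 1 := by
  induction m with
  | zero => simp [WW, SS]
  | succ m ih =>
    rw [WW_succ h.rel, SS, Module.End.mul_apply, h.WW_mul m _ _ (fun k hk => h.EE_lt k m hk),
      ih (by omega), one_mul, h.dd_EE m (by omega)]

lemma Act.idem (h : Act D x N) (m : ℕ) (hm : m ≤ N) (f : P) :
    WW D m (SS x m * WW D m f) = WW D m f := by
  rw [h.WW_mul, h.WW_SS m hm, one_mul]
  intro k hk
  rw [← Module.End.mul_apply, D_WW h.rel m k hk, LinearMap.zero_apply]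

lemma Act.shift (h : Act D x (N + 1)) : Act (fun k => D (k + 1)) (fun k => x (k + 1)) N where
  rel := h.rel.shift
  leib k := h.leib _
  one k := h.one _
  far k j h1 h2 := h.far _ _ (by omega) (by omega)
  near k := h.near _
  self k hk := h.self _ (by omega)

lemma Act.absorb1 (h : Act D x (N + 1)) (f : P) :
    WW D (N + 1) (SS (fun k => x (k + 1)) N * WW (fun k => D (k + 1)) N f) = WW D (N + 1) f := by
  rw [WW_succ' h.rel, Module.End.mul_apply, h.shift.idem N le_rfl, Module.End.mul_apply]

lemma Act.absorb2 (h : Act D x (N + 1)) (f : P) :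
    WW D (N + 1) (SS x N * WW D N f) = WW D (N + 1) f := by
  rw [WW_succ h.rel, Module.End.mul_apply, h.idem N (by omega), Module.End.mul_apply]

lemma EE_eq (x : ℕ → P) (m : ℕ) : EE x m = ∏ i ∈ Finset.range m, x i := by
  induction m with
  | zero => simp [EE]
  | succ m ih => rw [EE, ih, Finset.prod_range_succ]

lemma SS_eq (x : ℕ → P) (m : ℕ) : SS x m = ∏ i ∈ Finset.range m, x i ^ (m - 1 - i) := by
  induction m with
  | zero => simp [SS]
  | succ m ih =>
    rw [SS, ih, EE_eq, Finset.prod_range_succ, ← Finset.prod_mul_distrib]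
    simp only [Nat.add_sub_cancel, Nat.sub_self, pow_zero, mul_one]
    refine Finset.prod_congr rfl fun i hi => ?_
    rw [← pow_succ]
    congr 1
    have := Finset.mem_range.1 hi
    omega

end act

section concrete

/-- Relations for commutative-domain divided differences. -/
lemma dd_inv {P : Type*} [CommRing P] [IsDomain P] (s : P →+* P) (d : P → P) (a b : P)
    (hab : a ≠ b) (ha : s a = b) (hb : s b = a) (hs : ∀ f, s (s f) = f)
    (h : ∀ f, (a - b) * d f = f - s f) (f : P) : s (d f) = d f := by
  have h1 := congrArg s (h f)
  simp only [map_mul, map_sub, ha, hb, hs] at h1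
  exact mul_left_cancel₀ (sub_ne_zero.2 hab) (by linear_combination -h1 - h f)

lemma dd_braid {P : Type*} [CommRing P] [IsDomain P] (s t : P →+* P) (d e : P → P) (a b c : P)
    (hab : a ≠ b) (hac : a ≠ c) (hbc : b ≠ c)
    (hsa : s a = b) (hsb : s b = a) (hsc : s c = c)
    (hta : t a = a) (htb : t b = c) (htc : t c = b)
    (hs : ∀ f, s (s f) = f) (ht : ∀ f, t (t f) = f) (hst : ∀ f, s (t (s f)) = t (s (t f)))
    (hd : ∀ f, (a - b) * d f = f - s f) (he : ∀ f, (b - c) * e f = f - t f) (f : P) :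
    d (e (d f)) = e (d (e f)) := by
  have id := dd_inv s d a b hab hsa hsb hs hd
  have ie := dd_inv t e b c hbc htb htc ht he
  have A : (a - b) * (a - c) * (b - c) * d (e (d f)) =
      f - s f - t f + t (s f) + s (t f) - s (t (s f)) := by
    have h1 := hd (e (d f))
    have h2 := he (d f)
    have h3 := congrArg s h2
    have h4 := hd f
    have h5 := congrArg t h4
    have h6 := congrArg s h5
    simp only [map_mul, map_sub, hsa, hsb, hsc, hta, htb, htc, id] at h3 h5 h6
    linear_combination (a - c) * (b - c) * h1 + (a - c) * h2 - (b - c) * h3 + h4 - h5 + h6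
  have B : (a - b) * (a - c) * (b - c) * e (d (e f)) =
      f - s f - t f + t (s f) + s (t f) - t (s (t f)) := by
    have h1 := he (d (e f))
    have h2 := hd (e f)
    have h3 := congrArg t h2
    have h4 := he f
    have h5 := congrArg s h4
    have h6 := congrArg t h5
    simp only [map_mul, map_sub, hsa, hsb, hsc, hta, htb, htc, ie] at h3 h5 h6
    linear_combination (a - c) * (a - b) * h1 + (a - c) * h2 - (a - b) * h3 + h4 - h5 + h6
  refine mul_left_cancel₀ (mul_ne_zero (mul_ne_zero (sub_ne_zero.2 hab) (sub_ne_zero.2 hac))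
    (sub_ne_zero.2 hbc)) ?_
  rw [A, B, hst]

lemma dd_far {P : Type*} [CommRing P] [IsDomain P] (s t : P →+* P) (d e : P → P) (a b a' b' : P)
    (hab : a ≠ b) (hab' : a' ≠ b')
    (hsa : s a' = a') (hsb : s b' = b')
    (hta : t a = a) (htb : t b = b) (hst : ∀ f, s (t f) = t (s f))
    (hd : ∀ f, (a - b) * d f = f - s f) (he : ∀ f, (a' - b') * e f = f - t f) (f : P) :
    d (e f) = e (d f) := by
  refine mul_left_cancel₀ (mul_ne_zero (sub_ne_zero.2 hab) (sub_ne_zero.2 hab')) ?_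
  have h1 := hd (e f)
  have h2 := he f
  have h3 := congrArg s h2
  have h4 := he (d f)
  have h5 := hd f
  have h6 := congrArg t h5
  simp only [map_mul, map_sub, hsa, hsb, hta, htb, hst] at h3 h6
  linear_combination (a' - b') * h1 + h2 - h3 - (a - b) * h4 - h5 + h6

open MvPolynomial

variable {n : ℕ}

def xx (n : ℕ) (i : ℕ) : MvPolynomial (Fin n) ℤ := if h : i < n then X ⟨i, h⟩ else 0

def swp (n k : ℕ) : Equiv.Perm (Fin n) :=
  if h : k + 1 < n then Equiv.swap ⟨k, Nat.lt_of_succ_lt h⟩ ⟨k + 1, h⟩ else 1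

def ss (n k : ℕ) : MvPolynomial (Fin n) ℤ →+* MvPolynomial (Fin n) ℤ :=
  (rename (swp n k) : MvPolynomial (Fin n) ℤ →ₐ[ℤ] MvPolynomial (Fin n) ℤ)

def DT (D : ℕ → MvPolynomial (Fin n) ℤ →ₗ[ℤ] MvPolynomial (Fin n) ℤ) (k : ℕ) :
    Module.End ℤ (MvPolynomial (Fin n) ℤ) := if k + 1 < n then D k else 0

lemma ss_apply (k : ℕ) (f : MvPolynomial (Fin n) ℤ) : ss n k f = rename (swp n k) f := rfl

lemma swp_val (k : ℕ) (hk : k + 1 < n) (i : Fin n) :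
    ((swp n k i : Fin n) : ℕ) = if (i : ℕ) = k then k + 1 else if (i : ℕ) = k + 1 then k else i := by
  rw [swp, dif_pos hk, Equiv.swap_apply_def]
  simp only [Fin.ext_iff]
  split_ifs <;> rfl

lemma ss_xx (k j : ℕ) (hk : k + 1 < n) : ss n k (xx n j) =
    xx n (if j = k then k + 1 else if j = k + 1 then k else j) := by
  by_cases hj : j < n
  · have h2 : (if j = k then k + 1 else if j = k + 1 then k else j) < n := by
      split_ifs <;> omega
    rw [xx, dif_pos hj, xx, dif_pos h2, ss_apply, rename_X]
    congr 1
    ext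
    rw [swp_val k hk]
  · rw [if_neg (by omega), if_neg (by omega), xx, dif_neg hj, map_zero]

lemma ss_ss (k : ℕ) (f : MvPolynomial (Fin n) ℤ) : ss n k (ss n k f) = f := by
  rw [ss_apply, ss_apply, rename_rename]
  have : (swp n k : Fin n → Fin n) ∘ swp n k = id := by
    funext i
    rw [swp]
    split_ifs <;> simp
  rw [this, rename_id_apply]

lemma ss_braid (k : ℕ) (hk : k + 2 < n) (f : MvPolynomial (Fin n) ℤ) :
    ss n k (ss n (k + 1) (ss n k f)) = ss n (k + 1) (ss n k (ss n (k + 1) f)) := by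
  simp only [ss_apply, rename_rename]
  congr 2
  funext i
  ext
  simp only [Function.comp, swp_val k (show k + 1 < n by omega), swp_val (k + 1) hk]
  split_ifs <;> omega

lemma ss_far (k j : ℕ) (hkj : k + 1 < j) (hj : j + 1 < n) (f : MvPolynomial (Fin n) ℤ) :
    ss n k (ss n j f) = ss n j (ss n k f) := by
  simp only [ss_apply, rename_rename]
  congr 2
  funext i
  ext
  simp only [Function.comp, swp_val k (show k + 1 < n by omega), swp_val j hj]
  split_ifs <;> omega

lemma xx_ne (i j : ℕ) (hi : i < n) (hj : j < n) (h : i ≠ j) : xx n i ≠ xx n j := by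
  rw [xx, xx, dif_pos hi, dif_pos hj]
  intro h'
  exact h (Fin.mk.inj_iff.1 (X_injective h'))

variable {D : ℕ → MvPolynomial (Fin n) ℤ →ₗ[ℤ] MvPolynomial (Fin n) ℤ}

lemma DT_spec (hD : IsDDiff D) (k : ℕ) (hk : k + 1 < n) (f : MvPolynomial (Fin n) ℤ) :
    (xx n k - xx n (k + 1)) * DT D k f = f - ss n k f := by
  rw [xx, xx, dif_pos hk, dif_pos (by omega), DT, if_pos hk, hD k hk, ss_apply, swp, dif_pos hk]

lemma DT_zero (k : ℕ) (hk : ¬ k + 1 < n) : DT D k = 0 := by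
  rw [DT, if_neg hk]

lemma DT_of_inv (hD : IsDDiff D) (k : ℕ) (f : MvPolynomial (Fin n) ℤ) 
    (hf : k + 1 < n → ss n k f = f) : DT D k f = 0 := by
  by_cases hk : k + 1 < n
  · have := DT_spec hD k hk f
    rw [hf hk, sub_self] at this
    exact (mul_eq_zero.1 this).resolve_left
      (sub_ne_zero.2 (xx_ne _ _ (by omega) hk (by omega)))
  · rw [DT_zero k hk]; rfl

lemma act (hD : IsDDiff D) : Act (DT D) (xx n) n where
  rel := 
    { sq := fun k => by
        refine LinearMap.ext fun f => ?_
        rw [Module.End.mul_apply, LinearMap.zero_apply]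
        refine DT_of_inv hD k _ fun hk => ?_
        exact dd_inv (ss n k) (DT D k) (xx n k) (xx n (k + 1)) 
          (xx_ne _ _ (by omega) hk (by omega)) (by rw [ss_xx k _ hk]; simp) 
          (by rw [ss_xx k _ hk]; simp) (ss_ss k) (DT_spec hD k hk) f
      comm := fun i j hij => by
        by_cases hj : j + 1 < n
        · have hi : i + 1 < n := by omega
          refine LinearMap.ext fun f => ?_
          rw [Module.End.mul_apply, Module.End.mul_apply]
          refine dd_far (ss n i) (ss n j) (DT D i) (DT D j) (xx n i) (xx n (i + 1)) (xx n j)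
            (xx n (j + 1)) (xx_ne _ _ (by omega) (by omega) (by omega))
            (xx_ne _ _ (by omega) (by omega) (by omega)) ?_ ?_ ?_ ?_ (ss_far i j hij hj)
            (DT_spec hD i hi) (DT_spec hD j hj) f
          all_goals
            first | rw [ss_xx i _ hi] | rw [ss_xx j _ hj]
            congr 1
            split_ifs <;> omega
        · rw [DT_zero j hj, mul_zero, zero_mul]
      braid := fun k => by
        by_cases hj : k + 1 + 1 < n
        · have hi : k + 1 < n := by omega
          refine LinearMap.ext fun f => ?_
          simp only [Module.End.mul_apply]
          refine dd_braid (ss n k) (ss n (k + 1)) (DT D k) (DT D (k + 1)) (xx n k) (xx n (k + 1))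
            (xx n (k + 1 + 1)) (xx_ne _ _ (by omega) (by omega) (by omega))
            (xx_ne _ _ (by omega) (by omega) (by omega))
            (xx_ne _ _ (by omega) (by omega) (by omega)) ?_ ?_ ?_ ?_ ?_ ?_ (ss_ss _) (ss_ss _)
            (ss_braid k hj) (DT_spec hD k hi) (DT_spec hD _ hj) f
          all_goals
            first | rw [ss_xx k _ hi] | rw [ss_xx (k + 1) _ hj]
            congr 1
            split_ifs <;> omega
        · rw [DT_zero (k + 1) hj]; simp }
  leib k f g hg := by
    by_cases hk : k + 1 < n
    · have h0 := sub_ne_zero.2 (xx_ne (n := n) k (k + 1) (by omega) hk (by omega))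
      refine mul_left_cancel₀ h0 ?_
      have h1 := DT_spec hD k hk g
      rw [hg] at h1
      have h2 := DT_spec hD k hk f
      have h3 := DT_spec hD k hk (f * g)
      rw [map_mul (ss n k)] at h3
      linear_combination h3 - g * h2 - (ss n k f) * h1
    · rw [DT_zero k hk]; simp
  one k := DT_of_inv hD k _ fun _ => map_one _
  far k j h1 h2 := DT_of_inv hD k _ fun hk => by rw [ss_xx k _ hk, if_neg h1, if_neg h2]
  near k := DT_of_inv hD k _ fun hk => by
    rw [map_mul, ss_xx k _ hk, ss_xx k _ hk]
    simp [mul_comm]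
  self k hk := by
    have h0 := sub_ne_zero.2 (xx_ne (n := n) k (k + 1) (by omega) hk (by omega))
    refine mul_left_cancel₀ h0 ?_
    rw [DT_spec hD k hk, ss_xx k _ hk, if_pos rfl, mul_one]

lemma foldr_eq (D : ℕ → MvPolynomial (Fin n) ℤ →ₗ[ℤ] MvPolynomial (Fin n) ℤ) (l : List ℕ) :
    l.foldr (fun k acc => (D k).comp acc) LinearMap.id =
      (l.map (D : ℕ → Module.End ℤ (MvPolynomial (Fin n) ℤ))).prod := by
  induction l with
  | nil => rfl
  | cons a l ih => rw [List.foldr_cons, ih, List.map_cons, List.prod_cons]; rfl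

end concrete

end NilAux

/-- e_n ∘ e'_{n-1} = e_n and e_n ∘ e''_{n-1} = e_n, where e'_{n-1} and
e''_{n-1} are the analogues of e_{n-1} built on the last, resp. first, n-1 variables. -/
theorem en_absorbs {n : ℕ} (hn : 2 ≤ n)
    (D : ℕ → MvPolynomial (Fin n) ℤ →ₗ[ℤ] MvPolynomial (Fin n) ℤ) (hD : IsDDiff D) :
    (∀ f : MvPolynomial (Fin n) ℤ,
      staircase n * longOp D (staircase' n * longOp' D f) = staircase n * longOp D f) ∧
    (∀ f : MvPolynomial (Fin n) ℤ,
      staircase n * longOp D (staircase'' n * longOp'' D f) = staircase n * longOp D f) := by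
  obtain ⟨m, rfl⟩ : ∃ m, n = m + 2 := ⟨n - 2, by omega⟩
  have A := NilAux.act hD
  have hc : ∀ k, k + 1 < m + 2 → D k = NilAux.DT D k := fun k hk => by
    rw [NilAux.DT, if_pos hk]
  have e1 : longOp D = NilAux.WW (NilAux.DT D) (m + 2) := by
    rw [longOp, NilAux.foldr_eq, nilWord]
    exact (NilAux.WW_list _ (m + 1)).trans (NilAux.WW_congr _ hc)
  have e2 : longOp'' D = NilAux.WW (NilAux.DT D) (m + 1) := by
    rw [longOp'', NilAux.foldr_eq, nilWord]
    exact (NilAux.WW_list _ m).trans (NilAux.WW_congr _ fun k hk => hc k (by omega))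
  have e3 : longOp' D = NilAux.WW (fun k => NilAux.DT D (k + 1)) (m + 1) := by
    rw [longOp', NilAux.foldr_eq, nilWord', ← List.map_flatMap, List.map_map]
    exact (NilAux.WW_list _ m).trans (NilAux.WW_congr _ fun k hk => hc (k + 1) (by omega))
  have s2 : staircase'' (m + 2) = NilAux.SS (NilAux.xx (m + 2)) (m + 1) := by
    rw [NilAux.SS_eq, staircase'', Fin.prod_univ_castSucc, ← Fin.prod_univ_eq_prod_range
      (fun i => NilAux.xx (m + 2) i ^ (m + 1 - 1 - i))]
    have : m + 2 - 2 - (m + 1) = 0 := by omega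
    simp only [Fin.val_last, this, pow_zero, mul_one]
    refine Finset.prod_congr rfl fun i _ => ?_
    rw [NilAux.xx, dif_pos (by omega)]
    rfl
  have s3 : staircase' (m + 2) = NilAux.SS (fun k => NilAux.xx (m + 2) (k + 1)) (m + 1) := by
    rw [NilAux.SS_eq, staircase', Fin.prod_univ_succ, ← Fin.prod_univ_eq_prod_range
      (fun i => NilAux.xx (m + 2) (i + 1) ^ (m + 1 - 1 - i))]
    simp only [Fin.val_zero, if_true, pow_zero, one_mul]
    refine Finset.prod_congr rfl fun i _ => ?_
    rw [NilAux.xx, dif_pos (by omega), Fin.val_succ, if_neg (by omega)]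
    congr 1
    omega
  constructor
  · intro f
    rw [e1, e3, s3, A.absorb1]
  · intro f
    rw [e1, e2, s2, A.absorb2]
end
end
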